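/- arXiv:1607.06650 — 2 statements merged into one kernel-verified Lean document; each statement's English description precedes it below -/
import Mathlib

section
/- Harmonic-oscillator homological equation with frequencies. Let l = 1, λ(x,ξ) := (1+x²+ξ²)^{1/2}, ⟨x⟩ := √(1+x²), and let R_t(x,ξ) := (x cos t + ξ sin t, ξ cos t − x sin t). Fix n ≥ 1, τ > 0, γ > 0 and ω ∈ [1,2]^n satisfying |ω·k + k₀| ≥ γ/(1+|k|^τ) for all (k₀,k) ∈ ℤ^{1+n}∖{0}. Let p ∈ C^∞(𝕋^n × ℝ²) satisfy, for all multi-indices β and all k₁,k₂ ≥ 0, |∂_φ^β ∂_ξ^{k₁} ∂_x^{k₂} p(φ,x,ξ)| ≤ C_{β,k₁,k₂} λ(x,ξ)^{m₁−k₁} ⟨x⟩^{m₂−k₂}. Define the double average ⟨p̄⟩(x,ξ) := (2π)^{−(n+1)} ∫_{𝕋^n} ∫₀^{2π} p(φ, R_t(x,ξ)) dt dφ. Then there exists χ ∈ C^∞(𝕋^n × ℝ²) with |∂_φ^β ∂_ξ^{k₁} ∂_x^{k₂} χ(φ,x,ξ)| ≤ C′_{β,k₁,k₂} λ(x,ξ)^{m₁+[m₂]−k₁}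 ⟨x⟩^{−k₂} for all β,k₁,k₂, such that for all (φ,x,ξ): (d/dt)|_{t=0} χ(φ, R_t(x,ξ)) + ω·∂_φ χ(φ,x,ξ) = p(φ,x,ξ) − ⟨p̄⟩(x,ξ). -/
open Real MeasureTheory intervalIntegral

noncomputable section

/-- Partial derivative in the `j`-th angle variable. -/
def pderivAt (n : ℕ) (j : Fin n) (f : (Fin n → ℝ) → ℝ) (φ : Fin n → ℝ) : ℝ :=
  deriv (fun s => f (Function.update φ j s)) (φ j)

/-- The multi-index derivative `∂_φ^β = ∏_j ∂_{φ_j}^{β_j}`. -/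
def multiPderiv (n : ℕ) (β : Fin n → ℕ) (f : (Fin n → ℝ) → ℝ) : (Fin n → ℝ) → ℝ :=
  (List.finRange n).foldr (fun j g => (pderivAt n j)^[β j] g) f

/-- The double average `⟨p̄⟩(x,ξ) = (2π)^{-(n+1)} ∫_{𝕋^n}∫₀^{2π} p(φ,R_t(x,ξ)) dt dφ`. -/
def dblAvg (n : ℕ) (p : (Fin n → ℝ) → ℝ → ℝ → ℝ) (x ξ : ℝ) : ℝ :=
  ((2 * π) ^ (n + 1))⁻¹ *
    ∫ φ in Set.pi Set.univ (fun _ : Fin n => Set.Icc (0:ℝ) (2 * π)),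
      ∫ t in (0:ℝ)..(2 * π),
        p φ (x * Real.cos t + ξ * Real.sin t) (ξ * Real.cos t - x * Real.sin t)

/-- The space of angles and phase-space variables `(φ, x, ξ)`. -/
abbrev PhaseSpace (n : ℕ) := (Fin n → ℝ) × ℝ × ℝ

namespace PhaseSpace

variable {n : ℕ}

/-- The derivative of `f` in the constant direction `w`. -/
def dirDeriv (w : PhaseSpace n) (f : PhaseSpace n → ℝ) : PhaseSpace n → ℝ :=
  fun q => fderiv ℝ f q w

/-- The unit vector of the `j`-th angle. -/
def eAng (j : Fin n) : PhaseSpace n := (Pi.single j 1, 0, 0)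

/-- The unit vector of the position variable. -/
def ePos : PhaseSpace n := (0, 1, 0)

/-- The unit vector of the momentum variable. -/
def eMom : PhaseSpace n := (0, 0, 1)

/-- The symbol weight `λ(x,ξ)`. -/
def lam (q : PhaseSpace n) : ℝ := Real.sqrt (1 + q.2.1 ^ 2 + q.2.2 ^ 2)

/-- The weight `⟨x⟩`. -/
def jap (q : PhaseSpace n) : ℝ := Real.sqrt (1 + q.2.1 ^ 2)

lemma one_le_jap (q : PhaseSpace n) : 1 ≤ jap q := by
  rw [jap, Real.one_le_sqrt]; nlinarith [sq_nonneg q.2.1]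

lemma jap_le_lam (q : PhaseSpace n) : jap q ≤ lam q := by
  apply Real.sqrt_le_sqrt; nlinarith [sq_nonneg q.2.2]

lemma jap_pos (q : PhaseSpace n) : 0 < jap q := zero_lt_one.trans_le (one_le_jap q)

lemma lam_pos (q : PhaseSpace n) : 0 < lam q := (jap_pos q).trans_le (jap_le_lam q)

lemma weight_le {a b a' b' : ℝ} (h₁ : a ≤ a') (h₂ : a + b ≤ a' + b') (q : PhaseSpace n) :
    lam q ^ a * jap q ^ b ≤ lam q ^ a' * jap q ^ b' := by
  have hj := jap_pos q
  have hl := lam_pos q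
  have key : jap q ^ (b - b') ≤ lam q ^ (a' - a) :=
    (Real.rpow_le_rpow_of_exponent_le (one_le_jap q) (by linarith)).trans
      (Real.rpow_le_rpow hj.le (jap_le_lam q) (by linarith))
  calc lam q ^ a * jap q ^ b = lam q ^ a * jap q ^ b' * jap q ^ (b - b') := by
        rw [mul_assoc, ← Real.rpow_add hj]; congr 2; ring
    _ ≤ lam q ^ a * jap q ^ b' * lam q ^ (a' - a) := by gcongr
    _ = lam q ^ a' * jap q ^ b' := by
        rw [mul_right_comm, ← Real.rpow_add hl]; congr 2; ring

/-- Symbol estimates for all derivatives of order at most `N`. -/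
def SymbN : ℕ → ℝ → ℝ → (PhaseSpace n → ℝ) → Prop
  | 0, a, b, f => ContDiff ℝ (⊤ : ℕ∞) f ∧ ∃ C : ℝ, ∀ q, |f q| ≤ C * (lam q ^ a * jap q ^ b)
  | N + 1, a, b, f => (ContDiff ℝ (⊤ : ℕ∞) f ∧ ∃ C : ℝ, ∀ q, |f q| ≤ C * (lam q ^ a * jap q ^ b)) ∧
      (∀ j, SymbN N a b (dirDeriv (eAng j) f)) ∧ SymbN N (a - 1) b (dirDeriv eMom f) ∧
      SymbN N a (b - 1) (dirDeriv ePos f)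

/-- The symbol class `S^{a,b}`. -/
def Symb (a b : ℝ) (f : PhaseSpace n → ℝ) : Prop := ∀ N, SymbN N a b f

lemma SymbN.zero {N : ℕ} {a b : ℝ} {f : PhaseSpace n → ℝ} (h : SymbN N a b f) :
    SymbN 0 a b f := by
  cases N with
  | zero => exact h
  | succ N => exact h.1

lemma SymbN.contDiff {N : ℕ} {a b : ℝ} {f : PhaseSpace n → ℝ} (h : SymbN N a b f) :
    ContDiff ℝ (⊤ : ℕ∞) f := h.zero.1

lemma SymbN.of_succ {N : ℕ} {a b : ℝ} {f : PhaseSpace n → ℝ} (h : SymbN (N + 1) a b f) :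
    SymbN N a b f := by
  induction N generalizing a b f with
  | zero => exact h.1
  | succ N ih => exact ⟨h.1, fun j => ih (h.2.1 j), ih h.2.2.1, ih h.2.2.2⟩

lemma SymbN.mono {N : ℕ} {a b a' b' : ℝ} {f : PhaseSpace n → ℝ} (h : SymbN N a b f)
    (h₁ : a ≤ a') (h₂ : a + b ≤ a' + b') : SymbN N a' b' f := by
  have h0 : ∀ {a b a' b' : ℝ} {f : PhaseSpace n → ℝ}, SymbN 0 a b f → a ≤ a' →
      a + b ≤ a' + b' → SymbN 0 a' b' f := by
    rintro a b a' b' f ⟨hf, C, hC⟩ h₁ h₂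
    refine ⟨hf, |C|, fun q => (hC q).trans ?_⟩
    exact mul_le_mul (le_abs_self C) (weight_le h₁ h₂ q)
      (mul_nonneg (Real.rpow_nonneg (lam_pos q).le _) (Real.rpow_nonneg (jap_pos q).le _))
      (abs_nonneg C)
  induction N generalizing a b a' b' f with
  | zero => exact h0 h h₁ h₂
  | succ N ih =>
    exact ⟨h0 h.zero h₁ h₂, fun j => ih (h.2.1 j) h₁ h₂,
      ih h.2.2.1 (by linarith) (by linarith), ih h.2.2.2 (by linarith) (by linarith)⟩

lemma contDiff_dirDeriv {f : PhaseSpace n → ℝ} (hf : ContDiff ℝ (⊤ : ℕ∞) f) (w : PhaseSpace n) :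
    ContDiff ℝ (⊤ : ℕ∞) (dirDeriv w f) :=
  (hf.fderiv_right (m := (⊤ : ℕ∞)) (by simp)).clm_apply contDiff_const

lemma differentiable_of_smooth {f : PhaseSpace n → ℝ} (hf : ContDiff ℝ (⊤ : ℕ∞) f) :
    Differentiable ℝ f := hf.differentiable (by simp)

lemma dirDeriv_add {f g : PhaseSpace n → ℝ} (hf : Differentiable ℝ f) (hg : Differentiable ℝ g)
    (w : PhaseSpace n) : dirDeriv w (f + g) = dirDeriv w f + dirDeriv w g := by
  ext q
  simp [dirDeriv, fderiv_add (hf q) (hg q)]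

lemma dirDeriv_mul {f g : PhaseSpace n → ℝ} (hf : Differentiable ℝ f) (hg : Differentiable ℝ g)
    (w : PhaseSpace n) : dirDeriv w (f * g) = dirDeriv w f * g + f * dirDeriv w g := by
  ext q
  simp [dirDeriv, fderiv_mul (hf q) (hg q)]
  ring

lemma dirDeriv_const (c : ℝ) (w : PhaseSpace n) : dirDeriv w (fun _ => c) = 0 := by
  ext q
  simp [dirDeriv]

lemma dirDeriv_comm {f : PhaseSpace n → ℝ} (hf : ContDiff ℝ (⊤ : ℕ∞) f) (v w : PhaseSpace n) :
    dirDeriv v (dirDeriv w f) = dirDeriv w (dirDeriv v f) := by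
  have hd : Differentiable ℝ (fderiv ℝ f) :=
    (hf.fderiv_right (m := (⊤ : ℕ∞)) (by simp)).differentiable (by simp)
  have key : ∀ (u u' q : PhaseSpace n), dirDeriv u (dirDeriv u' f) q
      = fderiv ℝ (fderiv ℝ f) q u u' := by
    intro u u' q
    unfold dirDeriv
    rw [fderiv_clm_apply (hd q) (differentiableAt_const _)]
    simp
  ext q
  rw [key, key]
  exact (hf.contDiffAt.isSymmSndFDerivAt (by simpa using! (WithTop.coe_le_coe.2 (le_top : (2 : ℕ∞) ≤ ⊤)))) v w

lemma SymbN.add {N : ℕ} {a b : ℝ} {f g : PhaseSpace n → ℝ} (hf : SymbN N a b f)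
    (hg : SymbN N a b g) : SymbN N a b (f + g) := by
  have h0 : ∀ {a b : ℝ} {f g : PhaseSpace n → ℝ}, SymbN 0 a b f → SymbN 0 a b g →
      SymbN 0 a b (f + g) := by
    rintro a b f g ⟨hf, C, hC⟩ ⟨hg, D, hD⟩
    refine ⟨hf.add hg, C + D, fun q => ?_⟩
    rw [add_mul]
    exact (abs_add_le _ _).trans (add_le_add (hC q) (hD q))
  induction N generalizing a b f g with
  | zero => exact h0 hf hg
  | succ N ih =>
    have e := dirDeriv_add (differentiable_of_smooth hf.contDiff)
      (differentiable_of_smooth hg.contDiff)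
    refine ⟨h0 hf.zero hg.zero, fun j => ?_, ?_, ?_⟩
    · rw [e]; exact ih (hf.2.1 j) (hg.2.1 j)
    · rw [e]; exact ih hf.2.2.1 hg.2.2.1
    · rw [e]; exact ih hf.2.2.2 hg.2.2.2

lemma SymbN.mul {N : ℕ} {a b c d : ℝ} {f g : PhaseSpace n → ℝ} (hf : SymbN N a b f)
    (hg : SymbN N c d g) : SymbN N (a + c) (b + d) (f * g) := by
  have h0 : ∀ {a b c d : ℝ} {f g : PhaseSpace n → ℝ}, SymbN 0 a b f → SymbN 0 c d g →
      SymbN 0 (a + c) (b + d) (f * g) := by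
    rintro a b c d f g ⟨hf, C, hC⟩ ⟨hg, D, hD⟩
    refine ⟨hf.mul hg, C * D, fun q => ?_⟩
    rw [Pi.mul_apply, abs_mul, Real.rpow_add (lam_pos q), Real.rpow_add (jap_pos q)]
    calc |f q| * |g q| ≤ _ := mul_le_mul (hC q) (hD q) (abs_nonneg _) ((abs_nonneg _).trans (hC q))
      _ = _ := by ring
  induction N generalizing a b c d f g with
  | zero => exact h0 hf hg
  | succ N ih =>
    have e := dirDeriv_mul (differentiable_of_smooth hf.contDiff)
      (differentiable_of_smooth hg.contDiff)
    refine ⟨h0 hf.zero hg.zero, fun j => ?_, ?_, ?_⟩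
    · rw [e]; exact (ih (hf.2.1 j) hg.of_succ).add (ih hf.of_succ (hg.2.1 j))
    · rw [e]
      exact ((ih hf.2.2.1 hg.of_succ).mono (by linarith) (by linarith)).add
        ((ih hf.of_succ hg.2.2.1).mono (by linarith) (by linarith))
    · rw [e]
      exact ((ih hf.2.2.2 hg.of_succ).mono (by linarith) (by linarith)).add
        ((ih hf.of_succ hg.2.2.2).mono (by linarith) (by linarith))

lemma symb_zero (a b : ℝ) : Symb a b (0 : PhaseSpace n → ℝ) := by
  have h0 : ∀ a b : ℝ, SymbN 0 a b (0 : PhaseSpace n → ℝ) :=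
    fun a b => ⟨contDiff_const, 0, fun q => by simp⟩
  have e : ∀ w : PhaseSpace n, dirDeriv w 0 = 0 := fun w => dirDeriv_const 0 w
  intro N
  induction N generalizing a b with
  | zero => exact h0 a b
  | succ N ih => refine ⟨h0 a b, fun j => ?_, ?_, ?_⟩ <;> rw [e] <;> exact ih _ _

lemma symb_const (c : ℝ) : Symb 0 0 (fun _ : PhaseSpace n => c) := by
  have h0 : SymbN 0 0 0 (fun _ : PhaseSpace n => c) := ⟨contDiff_const, |c|, fun q => by simp⟩
  rintro (_ | N)
  · exact h0
  · refine ⟨h0, fun j => ?_, ?_, ?_⟩ <;> rw [dirDeriv_const] <;> exact symb_zero _ _ N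

lemma SymbN.const_mul {N : ℕ} {a b : ℝ} {f : PhaseSpace n → ℝ} (hf : SymbN N a b f) (c : ℝ) :
    SymbN N a b (fun q => c * f q) := by
  have h := (symb_const c N).mul hf
  rwa [zero_add, zero_add] at h

lemma SymbN.neg {N : ℕ} {a b : ℝ} {f : PhaseSpace n → ℝ} (hf : SymbN N a b f) :
    SymbN N a b (-f) := by
  convert hf.const_mul (-1) using 1
  ext q; simp

lemma SymbN.sub {N : ℕ} {a b : ℝ} {f g : PhaseSpace n → ℝ} (hf : SymbN N a b f)
    (hg : SymbN N a b g) : SymbN N a b (f - g) := by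
  rw [sub_eq_add_neg]; exact hf.add hg.neg

lemma SymbN.sum {N : ℕ} {a b : ℝ} {ι : Type*} (s : Finset ι) {f : ι → PhaseSpace n → ℝ}
    (hf : ∀ i ∈ s, SymbN N a b (f i)) : SymbN N a b (∑ i ∈ s, f i) :=
  Finset.sum_induction f (SymbN N a b) (fun _ _ => SymbN.add) (symb_zero a b N) hf

/-- A continuous linear coordinate whose derivatives in the unit directions are as prescribed
lies in the corresponding symbol class. -/
lemma symb_of_fderiv_const {a b : ℝ} {L : PhaseSpace n →L[ℝ] ℝ}
    (h0 : ∃ C : ℝ, ∀ q, |L q| ≤ C * (lam q ^ a * jap q ^ b))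
    (h1 : ∀ j, L (eAng j) = 0) (h2 : L eMom = 0 ∨ 1 ≤ a ∧ 1 ≤ a + b)
    (h3 : L ePos = 0 ∨ 0 ≤ a ∧ 1 ≤ a + b) : Symb a b (fun q => L q) := by
  have e : ∀ w : PhaseSpace n, dirDeriv w (fun q => L q) = fun _ => L w := by
    intro w; ext q; simp [dirDeriv]
  have hz : ∀ (a b : ℝ) N, SymbN N a b (fun _ : PhaseSpace n => (0 : ℝ)) :=
    fun a b N => symb_zero a b N
  rintro (_ | N)
  · exact ⟨L.contDiff, h0⟩
  · refine ⟨⟨L.contDiff, h0⟩, fun j => ?_, ?_, ?_⟩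
    · rw [e, h1]; exact hz _ _ N
    · rw [e]
      rcases h2 with h | ⟨h, h'⟩
      · rw [h]; exact hz _ _ N
      · exact (symb_const _ N).mono (by linarith) (by linarith)
    · rw [e]
      rcases h3 with h | ⟨h, h'⟩
      · rw [h]; exact hz _ _ N
      · exact (symb_const _ N).mono (by linarith) (by linarith)

lemma symb_pos : Symb 0 1 (fun q : PhaseSpace n => q.2.1) := by
  refine symb_of_fderiv_const (L := (ContinuousLinearMap.fst ℝ ℝ ℝ).comp
    (ContinuousLinearMap.snd ℝ (Fin n → ℝ) (ℝ × ℝ))) ⟨1, fun q => ?_⟩ (fun j => by simp [eAng])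
    (by simp [eMom]) (by norm_num)
  simp only [Real.rpow_zero, Real.rpow_one, one_mul]
  exact Real.abs_le_sqrt (by simp)

lemma symb_mom : Symb 1 0 (fun q : PhaseSpace n => q.2.2) := by
  refine symb_of_fderiv_const (L := (ContinuousLinearMap.snd ℝ ℝ ℝ).comp
    (ContinuousLinearMap.snd ℝ (Fin n → ℝ) (ℝ × ℝ))) ⟨1, fun q => ?_⟩ (fun j => by simp [eAng])
    (by norm_num) (by simp [ePos])
  simp only [Real.rpow_zero, Real.rpow_one, one_mul, mul_one]
  exact Real.abs_le_sqrt (by simp; positivity)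

/-- The function `λ⁻²`. -/
def lamInvSq (q : PhaseSpace n) : ℝ := (1 + q.2.1 ^ 2 + q.2.2 ^ 2)⁻¹

lemma lamInvSq_eq (q : PhaseSpace n) : lamInvSq q = lam q ^ (-2 : ℝ) := by
  rw [Real.rpow_neg (lam_pos q).le, lamInvSq, lam]
  norm_cast
  rw [Real.sq_sqrt (by positivity)]

lemma symb_lamInvSq : Symb (-2) 0 (lamInvSq : PhaseSpace n → ℝ) := by
  have hsm : ContDiff ℝ (⊤ : ℕ∞) (lamInvSq : PhaseSpace n → ℝ) := by
    unfold lamInvSq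
    refine ContDiff.inv (by fun_prop) fun q => by positivity
  have h0 : SymbN 0 (-2) 0 (lamInvSq : PhaseSpace n → ℝ) := by
    refine ⟨hsm, 1, fun q => ?_⟩
    rw [lamInvSq_eq, Real.rpow_zero, mul_one, one_mul,
      abs_of_nonneg (Real.rpow_nonneg (lam_pos q).le _)]
  have hder : ∀ w : PhaseSpace n, dirDeriv w lamInvSq =
      fun q => -2 * ((w.2.1 * q.2.1 + w.2.2 * q.2.2) * (lamInvSq q * lamInvSq q)) := by
    intro w
    ext q
    have hne : (1 + q.2.1 ^ 2 + q.2.2 ^ 2) ≠ 0 := by positivity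
    have h1 : HasFDerivAt (fun q : PhaseSpace n => q.2.1)
      ((ContinuousLinearMap.fst ℝ ℝ ℝ).comp (ContinuousLinearMap.snd ℝ (Fin n → ℝ) (ℝ × ℝ))) q :=
      ((ContinuousLinearMap.fst ℝ ℝ ℝ).comp
        (ContinuousLinearMap.snd ℝ (Fin n → ℝ) (ℝ × ℝ))).hasFDerivAt
    have h2 : HasFDerivAt (fun q : PhaseSpace n => q.2.2)
      ((ContinuousLinearMap.snd ℝ ℝ ℝ).comp (ContinuousLinearMap.snd ℝ (Fin n → ℝ) (ℝ × ℝ))) q :=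
      ((ContinuousLinearMap.snd ℝ ℝ ℝ).comp
        (ContinuousLinearMap.snd ℝ (Fin n → ℝ) (ℝ × ℝ))).hasFDerivAt
    have h3 := (((h1.pow 2).const_add 1).add (h2.pow 2))
    have h4 := (hasDerivAt_inv hne).comp_hasFDerivAt q h3
    have h5 : HasFDerivAt lamInvSq _ q := h4
    rw [dirDeriv, h5.fderiv]
    simp [lamInvSq]
    field_simp
    ring
  intro N
  induction N with
  | zero => exact h0
  | succ N ih =>
    refine ⟨h0, fun j => ?_, ?_, ?_⟩
    · rw [hder]; simp only [eAng, zero_mul, add_zero, mul_zero]; exact symb_zero _ _ N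
    · rw [hder]; simp only [eMom, zero_mul, zero_add, one_mul]
      exact SymbN.const_mul (((symb_mom N).mul (ih.mul ih)).mono (by norm_num) (by norm_num)) _
    · rw [hder]; simp only [ePos, zero_mul, add_zero, one_mul]
      exact SymbN.const_mul (((symb_pos N).mul (ih.mul ih)).mono (by norm_num) (by norm_num)) _

lemma contDiff_iterate_dirDeriv {f : PhaseSpace n → ℝ} (hf : ContDiff ℝ (⊤ : ℕ∞) f)
    (w : PhaseSpace n) (k : ℕ) : ContDiff ℝ (⊤ : ℕ∞) ((dirDeriv w)^[k] f) := by
  induction k with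
  | zero => exact hf
  | succ k ih => rw [Function.iterate_succ_apply']; exact contDiff_dirDeriv ih w

lemma iterate_dirDeriv_comm {f : PhaseSpace n → ℝ} (hf : ContDiff ℝ (⊤ : ℕ∞) f)
    (v w : PhaseSpace n) (k : ℕ) :
    (dirDeriv v)^[k] (dirDeriv w f) = dirDeriv w ((dirDeriv v)^[k] f) := by
  induction k with
  | zero => rfl
  | succ k ih =>
    rw [Function.iterate_succ_apply', Function.iterate_succ_apply', ih,
      dirDeriv_comm (contDiff_iterate_dirDeriv hf v k)]

/-- The iterated angle derivatives of multiplicities `β` in the directions of the list `l`. -/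
def angDeriv (β : Fin n → ℕ) (l : List (Fin n)) (f : PhaseSpace n → ℝ) : PhaseSpace n → ℝ :=
  l.foldr (fun j g => (dirDeriv (eAng j))^[β j] g) f

lemma contDiff_angDeriv {f : PhaseSpace n → ℝ} (hf : ContDiff ℝ (⊤ : ℕ∞) f)
    (β : Fin n → ℕ) (l : List (Fin n)) : ContDiff ℝ (⊤ : ℕ∞) (angDeriv β l f) := by
  induction l with
  | nil => exact hf
  | cons i l ih => exact contDiff_iterate_dirDeriv ih _ _

lemma angDeriv_dirDeriv {f : PhaseSpace n → ℝ} (hf : ContDiff ℝ (⊤ : ℕ∞) f)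
    (β : Fin n → ℕ) (l : List (Fin n)) (w : PhaseSpace n) :
    angDeriv β l (dirDeriv w f) = dirDeriv w (angDeriv β l f) := by
  induction l with
  | nil => rfl
  | cons i l ih =>
    change (dirDeriv (eAng i))^[β i] (angDeriv β l (dirDeriv w f)) = _
    rw [ih, iterate_dirDeriv_comm (contDiff_angDeriv hf β l)]
    rfl

lemma angDeriv_congr {β β' : Fin n → ℕ} {l : List (Fin n)} (h : ∀ i ∈ l, β i = β' i)
    (f : PhaseSpace n → ℝ) : angDeriv β l f = angDeriv β' l f := by
  induction l with
  | nil => rfl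
  | cons i l ih =>
    change (dirDeriv (eAng i))^[β i] (angDeriv β l f) = (dirDeriv (eAng i))^[β' i] (angDeriv β' l f)
    rw [ih fun i hi => h i (List.mem_cons_of_mem _ hi), h i List.mem_cons_self]

lemma angDeriv_update_succ {f : PhaseSpace n → ℝ} (hf : ContDiff ℝ (⊤ : ℕ∞) f)
    (β : Fin n → ℕ) {l : List (Fin n)} (hl : l.Nodup) {j : Fin n} (hj : j ∈ l) :
    angDeriv (Function.update β j (β j + 1)) l f = dirDeriv (eAng j) (angDeriv β l f) := by
  induction l with
  | nil => simp at hj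
  | cons i l ih =>
    rw [List.nodup_cons] at hl
    change (dirDeriv (eAng i))^[Function.update β j (β j + 1) i] (angDeriv _ l f) =
      dirDeriv (eAng j) ((dirDeriv (eAng i))^[β i] (angDeriv β l f))
    by_cases hij : i = j
    · subst hij
      rw [Function.update_self, Function.iterate_succ_apply']
      congr 2
      refine angDeriv_congr (fun k hk => ?_) f
      rw [Function.update_of_ne]
      rintro rfl
      exact hl.1 hk
    · rw [Function.update_of_ne hij, ih hl.2 ((List.mem_cons.1 hj).resolve_left (Ne.symm hij)),
        iterate_dirDeriv_comm (contDiff_angDeriv hf β l)]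

lemma deriv_pos {f : PhaseSpace n → ℝ} (hf : Differentiable ℝ f) (φ : Fin n → ℝ) (x ξ : ℝ) :
    deriv (fun x' => f (φ, x', ξ)) x = dirDeriv ePos f (φ, x, ξ) := by
  have h : HasDerivAt (fun x' : ℝ => ((φ, x', ξ) : PhaseSpace n)) ePos x :=
    (hasDerivAt_const x φ).prodMk ((hasDerivAt_id x).prodMk (hasDerivAt_const x ξ))
  exact ((hf _).hasFDerivAt.comp_hasDerivAt x h).deriv

lemma deriv_mom {f : PhaseSpace n → ℝ} (hf : Differentiable ℝ f) (φ : Fin n → ℝ) (x ξ : ℝ) :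
    deriv (fun ξ' => f (φ, x, ξ')) ξ = dirDeriv eMom f (φ, x, ξ) := by
  have h : HasDerivAt (fun ξ' : ℝ => ((φ, x, ξ') : PhaseSpace n)) eMom ξ :=
    (hasDerivAt_const ξ φ).prodMk ((hasDerivAt_const ξ x).prodMk (hasDerivAt_id ξ))
  exact ((hf _).hasFDerivAt.comp_hasDerivAt ξ h).deriv

lemma pderivAt_eq {f : PhaseSpace n → ℝ} (hf : Differentiable ℝ f) (j : Fin n)
    (φ : Fin n → ℝ) (z : ℝ × ℝ) :
    pderivAt n j (fun φ' => f (φ', z)) φ = dirDeriv (eAng j) f (φ, z) := by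
  have h : HasDerivAt (fun s : ℝ => ((Function.update φ j s, z) : PhaseSpace n)) (eAng j) (φ j) :=
    (hasDerivAt_update φ j (φ j)).prodMk (hasDerivAt_const _ z)
  have h' := (hf (Function.update φ j (φ j), z)).hasFDerivAt.comp_hasDerivAt (φ j) h
  rw [Function.update_eq_self] at h'
  exact h'.deriv

lemma iteratedDeriv_pos {f : PhaseSpace n → ℝ} (hf : ContDiff ℝ (⊤ : ℕ∞) f) (k : ℕ)
    (φ : Fin n → ℝ) (x ξ : ℝ) :
    iteratedDeriv k (fun x' => f (φ, x', ξ)) x = (dirDeriv ePos)^[k] f (φ, x, ξ) := by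
  induction k generalizing x with
  | zero => simp
  | succ k ih =>
    rw [iteratedDeriv_succ, Function.iterate_succ_apply', funext ih]
    exact deriv_pos (differentiable_of_smooth (contDiff_iterate_dirDeriv hf _ k)) φ x ξ

lemma iteratedDeriv_mom {f : PhaseSpace n → ℝ} (hf : ContDiff ℝ (⊤ : ℕ∞) f) (k : ℕ)
    (φ : Fin n → ℝ) (x ξ : ℝ) :
    iteratedDeriv k (fun ξ' => f (φ, x, ξ')) ξ = (dirDeriv eMom)^[k] f (φ, x, ξ) := by
  induction k generalizing ξ with
  | zero => simp
  | succ k ih =>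
    rw [iteratedDeriv_succ, Function.iterate_succ_apply', funext ih]
    exact deriv_mom (differentiable_of_smooth (contDiff_iterate_dirDeriv hf _ k)) φ x ξ

lemma iterate_pderivAt {f : PhaseSpace n → ℝ} (hf : ContDiff ℝ (⊤ : ℕ∞) f) (j : Fin n) (k : ℕ)
    (z : ℝ × ℝ) : (pderivAt n j)^[k] (fun φ => f (φ, z)) =
      fun φ => (dirDeriv (eAng j))^[k] f (φ, z) := by
  induction k with
  | zero => rfl
  | succ k ih =>
    rw [Function.iterate_succ_apply', Function.iterate_succ_apply', ih]
    ext φ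
    exact pderivAt_eq (differentiable_of_smooth (contDiff_iterate_dirDeriv hf _ k)) j φ z

lemma multiPderiv_eq {f : PhaseSpace n → ℝ} (hf : ContDiff ℝ (⊤ : ℕ∞) f) (β : Fin n → ℕ)
    (z : ℝ × ℝ) : multiPderiv n β (fun φ => f (φ, z)) =
      fun φ => angDeriv β (List.finRange n) f (φ, z) := by
  unfold multiPderiv angDeriv
  induction List.finRange n with
  | nil => rfl
  | cons i l ih =>
    rw [List.foldr_cons, List.foldr_cons, ih]
    exact iterate_pderivAt (contDiff_angDeriv hf β l) i (β i) z

lemma mixed_deriv_eq {f : PhaseSpace n → ℝ} (hf : ContDiff ℝ (⊤ : ℕ∞) f) (β : Fin n → ℕ)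
    (k₁ k₂ : ℕ) (φ : Fin n → ℝ) (x ξ : ℝ) :
    multiPderiv n β (fun φ' => iteratedDeriv k₁ (fun ξ' =>
      iteratedDeriv k₂ (fun x' => f (φ', x', ξ')) x) ξ) φ =
    angDeriv β (List.finRange n) ((dirDeriv eMom)^[k₁] ((dirDeriv ePos)^[k₂] f)) (φ, x, ξ) := by
  have h₂ := contDiff_iterate_dirDeriv hf ePos k₂
  simp only [iteratedDeriv_pos hf, iteratedDeriv_mom h₂]
  rw [multiPderiv_eq (contDiff_iterate_dirDeriv h₂ eMom k₁) β (x, ξ)]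

lemma Symb.contDiff {a b : ℝ} {f : PhaseSpace n → ℝ} (h : Symb a b f) :
    ContDiff ℝ (⊤ : ℕ∞) f := (h 0).1

lemma Symb.differentiable {a b : ℝ} {f : PhaseSpace n → ℝ} (h : Symb a b f) :
    Differentiable ℝ f := differentiable_of_smooth h.contDiff

lemma Symb.ang {a b : ℝ} {f : PhaseSpace n → ℝ} (h : Symb a b f) (j : Fin n) :
    Symb a b (dirDeriv (eAng j) f) := fun N => (h (N + 1)).2.1 j

lemma Symb.mom {a b : ℝ} {f : PhaseSpace n → ℝ} (h : Symb a b f) :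
    Symb (a - 1) b (dirDeriv eMom f) := fun N => (h (N + 1)).2.2.1

lemma Symb.pos {a b : ℝ} {f : PhaseSpace n → ℝ} (h : Symb a b f) :
    Symb a (b - 1) (dirDeriv ePos f) := fun N => (h (N + 1)).2.2.2

lemma Symb.iterate_mom {a b : ℝ} {f : PhaseSpace n → ℝ} (h : Symb a b f) (k : ℕ) :
    Symb (a - k) b ((dirDeriv eMom)^[k] f) := by
  induction k with
  | zero => simpa using h
  | succ k ih =>
    rw [Function.iterate_succ_apply']
    have := ih.mom
    push_cast
    rwa [sub_sub] at this

lemma Symb.iterate_pos {a b : ℝ} {f : PhaseSpace n → ℝ} (h : Symb a b f) (k : ℕ) :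
    Symb a (b - k) ((dirDeriv ePos)^[k] f) := by
  induction k with
  | zero => simpa using h
  | succ k ih =>
    rw [Function.iterate_succ_apply']
    have := ih.pos
    push_cast
    rwa [sub_sub] at this

lemma Symb.angDeriv {a b : ℝ} {f : PhaseSpace n → ℝ} (h : Symb a b f) (β : Fin n → ℕ)
    (l : List (Fin n)) : Symb a b (angDeriv β l f) := by
  induction l with
  | nil => exact h
  | cons i l ih =>
    change Symb a b ((dirDeriv (eAng i))^[β i] (PhaseSpace.angDeriv β l f))
    induction β i with
    | zero => exact ih
    | succ k ih => rw [Function.iterate_succ_apply']; exact ih.ang i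

lemma Symb.bound {a b : ℝ} {f : PhaseSpace n → ℝ} (h : Symb a b f) (β : Fin n → ℕ) (k₁ k₂ : ℕ) :
    ∃ C : ℝ, ∀ (φ : Fin n → ℝ) (x ξ : ℝ),
      |multiPderiv n β (fun φ' => iteratedDeriv k₁ (fun ξ' =>
          iteratedDeriv k₂ (fun x' => f (φ', x', ξ')) x) ξ) φ|
        ≤ C * Real.sqrt (1 + x ^ 2 + ξ ^ 2) ^ (a - (k₁ : ℝ))
            * Real.sqrt (1 + x ^ 2) ^ (b - (k₂ : ℝ)) := by
  obtain ⟨-, C, hC⟩ := (((h.iterate_pos k₂).iterate_mom k₁).angDeriv β (List.finRange n)) 0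
  refine ⟨C, fun φ x ξ => ?_⟩
  rw [mixed_deriv_eq h.contDiff, mul_assoc]
  exact hC (φ, x, ξ)

lemma symb_of_bound {a b : ℝ} {f : PhaseSpace n → ℝ} (hf : ContDiff ℝ (⊤ : ℕ∞) f)
    (h : ∀ (β : Fin n → ℕ) (k₁ k₂ : ℕ), ∃ C : ℝ, ∀ (φ : Fin n → ℝ) (x ξ : ℝ),
      |multiPderiv n β (fun φ' => iteratedDeriv k₁ (fun ξ' =>
          iteratedDeriv k₂ (fun x' => f (φ', x', ξ')) x) ξ) φ|
        ≤ C * Real.sqrt (1 + x ^ 2 + ξ ^ 2) ^ (a - (k₁ : ℝ))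
            * Real.sqrt (1 + x ^ 2) ^ (b - (k₂ : ℝ))) : Symb a b f := by
  have h' : ∀ (β : Fin n → ℕ) (k₁ k₂ : ℕ), ∃ C : ℝ, ∀ q,
      |angDeriv β (List.finRange n) ((dirDeriv eMom)^[k₁] ((dirDeriv ePos)^[k₂] f)) q|
        ≤ C * (lam q ^ (a - (k₁ : ℝ)) * jap q ^ (b - (k₂ : ℝ))) := by
    intro β k₁ k₂
    obtain ⟨C, hC⟩ := h β k₁ k₂
    refine ⟨C, fun q => ?_⟩
    have := hC q.1 q.2.1 q.2.2
    rwa [mixed_deriv_eq hf, mul_assoc] at this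
  clear h
  intro N
  induction N generalizing a b f with
  | zero =>
    refine ⟨hf, ?_⟩
    have e : ∀ l : List (Fin n), angDeriv 0 l f = f := by
      intro l
      induction l with
      | nil => rfl
      | cons i l ih => exact ih
    simpa [e] using h' 0 0 0
  | succ N ih =>
    have h0 := ih (a := a) (b := b) hf h'
    refine ⟨h0.zero, fun j => ih (contDiff_dirDeriv hf _) ?_, ih (contDiff_dirDeriv hf _) ?_,
      ih (contDiff_dirDeriv hf _) ?_⟩
    · intro β k₁ k₂
      have hx := contDiff_iterate_dirDeriv hf ePos k₂
      have hξ := contDiff_iterate_dirDeriv hx eMom k₁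
      rw [iterate_dirDeriv_comm hf, iterate_dirDeriv_comm hx, angDeriv_dirDeriv hξ,
        ← angDeriv_update_succ hξ β (List.nodup_finRange n) (List.mem_finRange j)]
      exact h' _ _ _
    · intro β k₁ k₂
      rw [iterate_dirDeriv_comm hf, ← Function.iterate_succ_apply]
      obtain ⟨C, hC⟩ := h' β (k₁ + 1) k₂
      refine ⟨C, fun q => (hC q).trans (le_of_eq ?_)⟩
      push_cast
      rw [sub_sub, add_comm (1 : ℝ)]
    · intro β k₁ k₂
      rw [← Function.iterate_succ_apply]
      obtain ⟨C, hC⟩ := h' β k₁ (k₂ + 1)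
      refine ⟨C, fun q => (hC q).trans (le_of_eq ?_)⟩
      push_cast
      rw [sub_sub, add_comm (1 : ℝ)]

/-- The Euler field `x ∂_x + ξ ∂_ξ`. -/
def euler (f : PhaseSpace n → ℝ) : PhaseSpace n → ℝ := fun q => fderiv ℝ f q (0, q.2.1, q.2.2)

/-- The generator `ξ ∂_x - x ∂_ξ` of the rotation flow. -/
def rotGen (f : PhaseSpace n → ℝ) : PhaseSpace n → ℝ := fun q => fderiv ℝ f q (0, q.2.2, -q.2.1)

lemma fderiv_zero_mk (f : PhaseSpace n → ℝ) (q : PhaseSpace n) (u v : ℝ) :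
    fderiv ℝ f q (0, u, v) = u * dirDeriv ePos f q + v * dirDeriv eMom f q := by
  have e : ((0, u, v) : PhaseSpace n) = u • ePos + v • eMom := by simp [ePos, eMom]
  rw [e, map_add, map_smul, map_smul]
  rfl

lemma fderiv_ang_mk (f : PhaseSpace n → ℝ) (q : PhaseSpace n) (u : Fin n → ℝ) :
    fderiv ℝ f q (u, 0, 0) = ∑ j, u j * dirDeriv (eAng j) f q := by
  have e : ((u, 0, 0) : PhaseSpace n) = ∑ j, u j • eAng j := by
    have h1 : (∑ j, u j • (eAng j : PhaseSpace n)).1 = u := by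
      rw [Prod.fst_sum]
      ext i
      simp [eAng, Finset.sum_apply, Pi.single_apply]
    have h2 : (∑ j, u j • (eAng j : PhaseSpace n)).2 = 0 := by
      rw [Prod.snd_sum]
      simp [eAng]
    exact Prod.ext h1.symm h2.symm
  rw [e, map_sum]
  simp [dirDeriv]

lemma euler_eq (f : PhaseSpace n → ℝ) :
    euler f = (fun q => q.2.1) * dirDeriv ePos f + (fun q => q.2.2) * dirDeriv eMom f := by
  ext q
  exact fderiv_zero_mk f q _ _

lemma rotGen_eq (f : PhaseSpace n → ℝ) :
    rotGen f = (fun q => q.2.2) * dirDeriv ePos f - (fun q => q.2.1) * dirDeriv eMom f := by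
  ext q
  simp only [rotGen, fderiv_zero_mk, Pi.sub_apply, Pi.mul_apply]
  ring

lemma Symb.euler {a b : ℝ} {f : PhaseSpace n → ℝ} (h : Symb a b f) : Symb a b (euler f) := by
  intro N
  rw [euler_eq]
  exact (((symb_pos N).mul (h.pos N)).mono (by linarith) (by linarith)).add
    (((symb_mom N).mul (h.mom N)).mono (by linarith) (by linarith))

lemma SymbN.of_self_improving {N : ℕ} {a : ℝ} {g h : PhaseSpace n → ℝ}
    (hgh : g = lamInvSq * g + h) (hh : SymbN N a 0 h) (K : ℕ) (hg : SymbN N (a + 2 * K) 0 g) :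
    SymbN N a 0 g := by
  induction K with
  | zero => simpa using hg
  | succ K ih =>
    apply ih
    rw [hgh]
    refine (((symb_lamInvSq N).mul hg).mono ?_ ?_).add (hh.mono ?_ ?_) <;> push_cast <;> linarith

/-- A family of functions with weak bounds, stable under the Euler field and the angle derivatives,
and on which the rotation generator causes no loss, consists of symbols. -/
lemma symbN_of_stable {M : ℝ} {G : (PhaseSpace n → ℝ) → Prop}
    (hweak : ∀ u, G u → ∀ N : ℕ, SymbN N (M + N) 0 u)
    (hE : ∀ u, G u → G (euler u)) (hφ : ∀ u, G u → ∀ j, G (dirDeriv (eAng j) u))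
    (hR : ∀ N, (∀ v, G v → SymbN N M 0 v) → ∀ u, G u → SymbN N M 0 (rotGen u))
    (N : ℕ) {u : PhaseSpace n → ℝ} (hu : G u) : SymbN N M 0 u := by
  induction N generalizing u with
  | zero => simpa using hweak u hu 0
  | succ N ih =>
    have hEu : SymbN N M 0 (euler u) := ih (hE u hu)
    have hRu : SymbN N M 0 (rotGen u) := hR N (fun v hv => ih hv) u hu
    have hw := hweak u hu (N + 1)
    have hq : ∀ q : PhaseSpace n, lamInvSq q * (1 + q.2.1 ^ 2 + q.2.2 ^ 2) = 1 := fun q =>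
      inv_mul_cancel₀ (by positivity)
    refine ⟨(ih hu).zero, fun j => ih (hφ u hu j), ?_, ?_⟩
    · refine SymbN.of_self_improving (h := lamInvSq * ((fun q => q.2.2) * euler u
        - (fun q => q.2.1) * rotGen u)) ?_ ?_ (N + 1) (hw.2.2.1.mono ?_ ?_)
      · rw [euler_eq, rotGen_eq]
        ext q
        simp only [Pi.add_apply, Pi.mul_apply, Pi.sub_apply]
        linear_combination (-dirDeriv eMom u q) * hq q
      · exact ((symb_lamInvSq N).mul ((((symb_mom N).mul hEu).mono le_rfl le_rfl).sub
          (((symb_pos N).mul hRu).mono (by linarith) (by linarith)))).mono (by linarith)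
            (by linarith)
      · push_cast; linarith
      · push_cast; linarith
    · refine SymbN.mono (a := M - 1) (b := 0) ?_ (by linarith) (by linarith)
      refine SymbN.of_self_improving (h := lamInvSq * ((fun q => q.2.1) * euler u
        + (fun q => q.2.2) * rotGen u)) ?_ ?_ (N + 1) (hw.2.2.2.mono ?_ ?_)
      · rw [euler_eq, rotGen_eq]
        ext q
        simp only [Pi.add_apply, Pi.mul_apply, Pi.sub_apply]
        linear_combination (-dirDeriv ePos u q) * hq q
      · exact ((symb_lamInvSq N).mul ((((symb_pos N).mul hEu).mono (a' := 1 + M) (b' := 0 + 0)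
          (by linarith) (by linarith)).add
          (((symb_mom N).mul hRu).mono le_rfl le_rfl))).mono (by linarith)
            (by linarith)
      · push_cast; linarith
      · push_cast; linarith

/-- The rotation by the angle `s` of the phase-space variables, as a linear map. -/
def rot (s : ℝ) : PhaseSpace n →L[ℝ] PhaseSpace n :=
  let X := (ContinuousLinearMap.fst ℝ ℝ ℝ).comp (ContinuousLinearMap.snd ℝ (Fin n → ℝ) (ℝ × ℝ))
  let Y := (ContinuousLinearMap.snd ℝ ℝ ℝ).comp (ContinuousLinearMap.snd ℝ (Fin n → ℝ) (ℝ × ℝ))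
  (ContinuousLinearMap.fst ℝ (Fin n → ℝ) (ℝ × ℝ)).prod 0 + Real.cos s • (0 : _ →L[ℝ] _).prod (X.prod Y)
    + Real.sin s • (0 : _ →L[ℝ] _).prod (Y.prod (-X))

lemma rot_apply (s : ℝ) (q : PhaseSpace n) :
    rot s q = (q.1, q.2.1 * Real.cos s + q.2.2 * Real.sin s,
      q.2.2 * Real.cos s - q.2.1 * Real.sin s) := by
  ext <;> simp [rot] <;> ring

lemma continuous_rot : Continuous (rot : ℝ → PhaseSpace n →L[ℝ] PhaseSpace n) := by
  unfold rot
  fun_prop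

/-- Translation of the angles by `b.1` and rotation of the phase-space variables by `b.2`. -/
def act (b : (Fin n → ℝ) × ℝ) (q : PhaseSpace n) : PhaseSpace n := rot b.2 q + (b.1, 0)

lemma continuous_act : Continuous fun r : ((Fin n → ℝ) × ℝ) × PhaseSpace n => act r.1 r.2 := by
  unfold act
  exact ((continuous_rot.comp (by fun_prop)).clm_apply continuous_snd).add (by fun_prop)

lemma act_eq (b : (Fin n → ℝ) × ℝ) (q : PhaseSpace n) :
    act b q = (q.1 + b.1, q.2.1 * Real.cos b.2 + q.2.2 * Real.sin b.2,
      q.2.2 * Real.cos b.2 - q.2.1 * Real.sin b.2) := by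
  rw [act, rot_apply]
  simp

lemma lam_act (b : (Fin n → ℝ) × ℝ) (q : PhaseSpace n) : lam (act b q) = lam q := by
  rw [act_eq, lam, lam]
  congr 1
  linear_combination (q.2.1 ^ 2 + q.2.2 ^ 2) * Real.sin_sq_add_cos_sq b.2

lemma hasFDerivAt_act (b : (Fin n → ℝ) × ℝ) (q : PhaseSpace n) :
    HasFDerivAt (act b) (rot b.2) q :=
  (rot b.2).hasFDerivAt.add_const _

section Transport

variable {Y : Type*} [MeasurableSpace Y] {μ : Measure Y}

/-- The weighted average of `f` over a family of transformations. -/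
def transport (μ : Measure Y) (b : Y → (Fin n → ℝ) × ℝ) (c : Y → ℝ) (f : PhaseSpace n → ℝ) :
    PhaseSpace n → ℝ := fun q => ∫ y, c y * f (act (b y) q) ∂μ

/-- A measurable kernel and a measurable family of transformations, both essentially bounded. -/
structure Admissible (μ : Measure Y) (b : Y → (Fin n → ℝ) × ℝ) (c : Y → ℝ) : Prop where
  meas_b : Measurable b
  meas_c : Measurable c
  bound_b : ∃ K : Set ((Fin n → ℝ) × ℝ), IsCompact K ∧ ∀ᵐ y ∂μ, b y ∈ K
  bound_c : ∃ B : ℝ, ∀ᵐ y ∂μ, |c y| ≤ B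

variable {b : Y → (Fin n → ℝ) × ℝ} {c : Y → ℝ}

lemma Admissible.cos (h : Admissible μ b c) : Admissible μ b (fun y => c y * Real.cos (b y).2) := by
  obtain ⟨B, hB⟩ := h.bound_c
  refine ⟨h.meas_b, h.meas_c.mul (Real.measurable_cos.comp h.meas_b.snd), h.bound_b, B, ?_⟩
  filter_upwards [hB] with y hy
  rw [abs_mul]
  exact (mul_le_of_le_one_right (abs_nonneg _) (Real.abs_cos_le_one _)).trans hy

lemma Admissible.sin (h : Admissible μ b c) : Admissible μ b (fun y => c y * Real.sin (b y).2) := by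
  obtain ⟨B, hB⟩ := h.bound_c
  refine ⟨h.meas_b, h.meas_c.mul (Real.measurable_sin.comp h.meas_b.snd), h.bound_b, B, ?_⟩
  filter_upwards [hB] with y hy
  rw [abs_mul]
  exact (mul_le_of_le_one_right (abs_nonneg _) (Real.abs_sin_le_one _)).trans hy

/-- A jointly continuous integrand is dominated by a constant, locally uniformly in the
parameter. -/
lemma Admissible.exists_bound (h : Admissible μ b c) {F : Type*} [NormedAddCommGroup F]
    [NormedSpace ℝ F] {Φ : ((Fin n → ℝ) × ℝ) × PhaseSpace n → F} (hΦ : Continuous Φ)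
    (q : PhaseSpace n) :
    ∃ D : ℝ, ∀ᵐ y ∂μ, ∀ q' ∈ Metric.closedBall q 1, ‖c y • Φ (b y, q')‖ ≤ D := by
  obtain ⟨K, hK, hbK⟩ := h.bound_b
  obtain ⟨B, hB⟩ := h.bound_c
  obtain ⟨D, hD⟩ := (hK.prod (isCompact_closedBall q 1)).exists_bound_of_continuousOn
    hΦ.continuousOn
  refine ⟨B * D, ?_⟩
  filter_upwards [hbK, hB] with y hy hy' q' hq'
  rw [norm_smul]
  exact mul_le_mul hy' (hD (b y, q') ⟨hy, hq'⟩) (norm_nonneg _) ((abs_nonneg _).trans hy')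

lemma Admissible.aestronglyMeasurable (h : Admissible μ b c) {F : Type*} [NormedAddCommGroup F]
    [NormedSpace ℝ F] {Φ : ((Fin n → ℝ) × ℝ) × PhaseSpace n → F} (hΦ : Continuous Φ)
    (q : PhaseSpace n) : AEStronglyMeasurable (fun y => c y • Φ (b y, q)) μ := by
  have h1 : StronglyMeasurable fun y => Φ (b y, q) :=
    (hΦ.comp (Continuous.prodMk_left q)).comp_stronglyMeasurable h.meas_b.stronglyMeasurable
  exact (h.meas_c.stronglyMeasurable.smul h1).aestronglyMeasurable

variable [IsFiniteMeasure μ]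

lemma Admissible.integrable (h : Admissible μ b c) {F : Type*} [NormedAddCommGroup F]
    [NormedSpace ℝ F] {Φ : ((Fin n → ℝ) × ℝ) × PhaseSpace n → F} (hΦ : Continuous Φ)
    (q : PhaseSpace n) : Integrable (fun y => c y • Φ (b y, q)) μ := by
  obtain ⟨D, hD⟩ := h.exists_bound hΦ q
  refine Integrable.of_bound (h.aestronglyMeasurable hΦ q) D ?_
  filter_upwards [hD] with y hy
  exact hy q (Metric.mem_closedBall_self zero_le_one)

lemma continuous_fderiv_act {f : PhaseSpace n → ℝ} (hf : ContDiff ℝ (⊤ : ℕ∞) f) :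
    Continuous fun r : ((Fin n → ℝ) × ℝ) × PhaseSpace n =>
      (fderiv ℝ f (act r.1 r.2)).comp (rot r.1.2) :=
  ((hf.continuous_fderiv (by simp)).comp continuous_act).clm_comp
    (continuous_rot.comp (by fun_prop))

lemma hasFDerivAt_transport (h : Admissible μ b c) {f : PhaseSpace n → ℝ}
    (hf : ContDiff ℝ (⊤ : ℕ∞) f) (q : PhaseSpace n) :
    HasFDerivAt (transport μ b c f)
      (∫ y, c y • (fderiv ℝ f (act (b y) q)).comp (rot (b y).2) ∂μ) q := by
  have hc0 : Continuous fun r : ((Fin n → ℝ) × ℝ) × PhaseSpace n => f (act r.1 r.2) :=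
    hf.continuous.comp continuous_act
  have hc1 := continuous_fderiv_act hf
  obtain ⟨D, hD⟩ := h.exists_bound hc1 q
  refine hasFDerivAt_integral_of_dominated_of_fderiv_le (bound := fun _ => D)
    (s := Metric.closedBall q 1)
    (F' := fun q y => c y • (fderiv ℝ f (act (b y) q)).comp (rot (b y).2))
    (Metric.closedBall_mem_nhds q one_pos)
    (Filter.Eventually.of_forall fun q' => h.aestronglyMeasurable hc0 q') (h.integrable hc0 q)
    (h.aestronglyMeasurable hc1 q) hD (integrable_const D)
    (Filter.Eventually.of_forall fun y q' _ => ?_)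
  exact (((differentiable_of_smooth hf _).hasFDerivAt).comp q'
    (hasFDerivAt_act (b y) q')).const_mul (c y)

lemma fderiv_transport (h : Admissible μ b c) {f : PhaseSpace n → ℝ}
    (hf : ContDiff ℝ (⊤ : ℕ∞) f) (q w : PhaseSpace n) :
    fderiv ℝ (transport μ b c f) q w =
      ∫ y, c y * fderiv ℝ f (act (b y) q) (rot (b y).2 w) ∂μ := by
  rw [(hasFDerivAt_transport h hf q).fderiv,
    ContinuousLinearMap.integral_apply (h.integrable (continuous_fderiv_act hf) q)]
  rfl

lemma transport_integrable (h : Admissible μ b c) {f : PhaseSpace n → ℝ}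
    (hf : Continuous f) (q : PhaseSpace n) :
    Integrable (fun y => c y * f (act (b y) q)) μ :=
  h.integrable (hf.comp continuous_act) q

lemma dirDeriv_ang_transport (h : Admissible μ b c) {f : PhaseSpace n → ℝ}
    (hf : ContDiff ℝ (⊤ : ℕ∞) f) (j : Fin n) :
    dirDeriv (eAng j) (transport μ b c f) = transport μ b c (dirDeriv (eAng j) f) := by
  ext q
  rw [dirDeriv, fderiv_transport h hf]
  simp only [rot_apply, eAng, zero_mul, add_zero, sub_zero]
  rfl

lemma dirDeriv_pos_transport (h : Admissible μ b c) {f : PhaseSpace n → ℝ}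
    (hf : ContDiff ℝ (⊤ : ℕ∞) f) :
    dirDeriv ePos (transport μ b c f) =
      transport μ b (fun y => c y * Real.cos (b y).2) (dirDeriv ePos f)
      - transport μ b (fun y => c y * Real.sin (b y).2) (dirDeriv eMom f) := by
  ext q
  rw [dirDeriv, fderiv_transport h hf, Pi.sub_apply, transport, transport, ← integral_sub
    (transport_integrable h.cos (contDiff_dirDeriv hf _).continuous q)
    (transport_integrable h.sin (contDiff_dirDeriv hf _).continuous q)]
  congr 1
  ext y
  simp only [rot_apply, ePos, fderiv_zero_mk]
  ring

lemma dirDeriv_mom_transport (h : Admissible μ b c) {f : PhaseSpace n → ℝ}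
    (hf : ContDiff ℝ (⊤ : ℕ∞) f) :
    dirDeriv eMom (transport μ b c f) =
      transport μ b (fun y => c y * Real.sin (b y).2) (dirDeriv ePos f)
      + transport μ b (fun y => c y * Real.cos (b y).2) (dirDeriv eMom f) := by
  ext q
  rw [dirDeriv, fderiv_transport h hf, Pi.add_apply, transport, transport, ← integral_add
    (transport_integrable h.sin (contDiff_dirDeriv hf _).continuous q)
    (transport_integrable h.cos (contDiff_dirDeriv hf _).continuous q)]
  congr 1
  ext y
  simp only [rot_apply, eMom, fderiv_zero_mk]
  ring

lemma euler_transport (h : Admissible μ b c) {f : PhaseSpace n → ℝ}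
    (hf : ContDiff ℝ (⊤ : ℕ∞) f) :
    euler (transport μ b c f) = transport μ b c (euler f) := by
  ext q
  rw [euler, fderiv_transport h hf]
  simp only [rot_apply, euler, transport, act_eq]

lemma fderiv_flow (f : PhaseSpace n → ℝ) (ω : Fin n → ℝ) (q : PhaseSpace n) :
    fderiv ℝ f q (ω, q.2.2, -q.2.1) = rotGen f q + ∑ j, ω j * dirDeriv (eAng j) f q := by
  rw [← fderiv_ang_mk, rotGen, ← map_add]
  simp

lemma contDiff_transport (h : Admissible μ b c) {f : PhaseSpace n → ℝ}
    (hf : ContDiff ℝ (⊤ : ℕ∞) f) : ContDiff ℝ (⊤ : ℕ∞) (transport μ b c f) := by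
  rw [contDiff_infty]
  intro N
  induction N generalizing c f with
  | zero =>
    exact contDiff_zero.2 (continuous_iff_continuousAt.2 fun q =>
      (hasFDerivAt_transport h hf q).continuousAt)
  | succ N ih =>
    push_cast
    rw [contDiff_succ_iff_fderiv_apply]
    refine ⟨fun q => (hasFDerivAt_transport h hf q).differentiableAt, by simp, fun w => ?_⟩
    have e : (fun q => fderiv ℝ (transport μ b c f) q w) = fun q =>
        (∑ j, w.1 j * dirDeriv (eAng j) (transport μ b c f) q) +
        (w.2.1 * dirDeriv ePos (transport μ b c f) q
          + w.2.2 * dirDeriv eMom (transport μ b c f) q) := by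
      ext q
      rw [← fderiv_ang_mk, ← fderiv_zero_mk, ← map_add]
      congr 1
      ext <;> simp
    rw [e]
    have h1 : ∀ j, ContDiff ℝ N (dirDeriv (eAng j) (transport μ b c f)) := fun j => by
      rw [dirDeriv_ang_transport h hf]; exact ih h (contDiff_dirDeriv hf _)
    have h2 : ContDiff ℝ N (dirDeriv ePos (transport μ b c f)) := by
      rw [dirDeriv_pos_transport h hf]
      exact (ih h.cos (contDiff_dirDeriv hf _)).sub (ih h.sin (contDiff_dirDeriv hf _))
    have h3 : ContDiff ℝ N (dirDeriv eMom (transport μ b c f)) := by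
      rw [dirDeriv_mom_transport h hf]
      exact (ih h.sin (contDiff_dirDeriv hf _)).add (ih h.cos (contDiff_dirDeriv hf _))
    fun_prop

/-- Averages of symbols satisfy symbol bounds with a loss. -/
lemma symbN_transport (h : Admissible μ b c) (N : ℕ) {f : PhaseSpace n → ℝ} {m₁ m₂ M : ℝ}
    (hf : Symb m₁ m₂ f) (h₁ : m₁ + N ≤ M) (h₂ : m₁ + m₂ + N ≤ M) :
    SymbN N M 0 (transport μ b c f) := by
  have h0 : ∀ {c : Y → ℝ} {f : PhaseSpace n → ℝ} {m₁ m₂ M : ℝ}, Admissible μ b c → Symb m₁ m₂ f →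
      m₁ ≤ M → m₁ + m₂ ≤ M → SymbN 0 M 0 (transport μ b c f) := by
    intro c f m₁ m₂ M h hf h₁ h₂
    obtain ⟨B, hB⟩ := h.bound_c
    obtain ⟨-, C, hC⟩ := (hf 0).mono (a' := M) (b' := 0) h₁ (by linarith)
    refine ⟨contDiff_transport h hf.contDiff, B * C * μ.real Set.univ, fun q => ?_⟩
    have := norm_integral_le_of_norm_le_const (μ := μ) (f := fun y => c y * f (act (b y) q))
      (C := B * (C * (lam q ^ M * jap q ^ (0 : ℝ)))) (by
        filter_upwards [hB] with y hy
        rw [norm_mul]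
        refine mul_le_mul hy ?_ (norm_nonneg _) ((abs_nonneg _).trans hy)
        have := hC (act (b y) q)
        rw [lam_act, Real.rpow_zero] at this
        rw [Real.rpow_zero]
        exact this)
    refine this.trans (le_of_eq ?_)
    ring
  induction N generalizing c f m₁ m₂ M with
  | zero => exact h0 h hf (by simpa using h₁) (by simpa using h₂)
  | succ N ih =>
    push_cast at h₁ h₂
    have hN : (0 : ℝ) ≤ N := N.cast_nonneg
    have hc := hf.contDiff
    refine ⟨h0 h hf (by linarith) (by linarith), fun j => ?_, ?_, ?_⟩
    · rw [dirDeriv_ang_transport h hc]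
      exact ih h (hf.ang j) (by linarith) (by linarith)
    · rw [dirDeriv_mom_transport h hc]
      exact (ih h.sin hf.pos (by linarith) (by linarith)).add
        (ih h.cos hf.mom (by linarith) (by linarith))
    · rw [dirDeriv_pos_transport h hc]
      refine SymbN.mono (a := M - 1) (b := 0) ?_ (by linarith) (by linarith)
      exact (ih h.cos hf.pos (by linarith) (by linarith)).sub
        (ih h.sin hf.mom (by linarith) (by linarith))

end Transport

section Torus

open UnitAddTorus

/-- The Haar probability measure of the torus. -/
def torusMeasure (n : ℕ) : Measure (UnitAddTorus (Fin n)) :=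
  Measure.pi fun _ => AddCircle.haarAddCircle

instance : IsProbabilityMeasure (torusMeasure n) :=
  inferInstanceAs (IsProbabilityMeasure (Measure.pi fun _ => AddCircle.haarAddCircle))

instance : (torusMeasure n).IsAddHaarMeasure :=
  inferInstanceAs (Measure.IsAddHaarMeasure (Measure.pi fun _ => AddCircle.haarAddCircle))

instance : (torusMeasure n).IsNegInvariant :=
  Measure.pi.isNegInvariant _

lemma mFourierCoeff_eq (f : UnitAddTorus (Fin n) → ℂ) (k : Fin n → ℤ) :
    mFourierCoeff f k = ∫ t, mFourier (-k) t * f t ∂torusMeasure n := rfl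

lemma mFourier_add_apply (k : Fin n → ℤ) (x y : UnitAddTorus (Fin n)) :
    mFourier k (x + y) = mFourier k x * mFourier k y := by
  simp [mFourier, Finset.prod_mul_distrib, smul_add, AddCircle.toCircle_add]

lemma mFourier_sub_apply (k : Fin n → ℤ) (x y : UnitAddTorus (Fin n)) :
    mFourier k (x - y) = mFourier k x * mFourier (-k) y := by
  rw [sub_eq_add_neg, mFourier_add_apply]
  simp [mFourier]

lemma norm_mFourier_apply (k : Fin n → ℤ) (x : UnitAddTorus (Fin n)) : ‖mFourier k x‖ = 1 := by
  simp only [mFourier, ContinuousMap.coe_mk, fourier_apply, norm_prod, Circle.norm_coe,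
    Finset.prod_const_one]

lemma integrable_of_continuous_torus {E : Type*} [NormedAddCommGroup E]
    {f : UnitAddTorus (Fin n) → E} (hf : Continuous f) :
    Integrable f (torusMeasure n) :=
  integrableOn_univ.1 (hf.continuousOn.integrableOn_compact isCompact_univ)

lemma norm_mFourierCoeff_le {f : UnitAddTorus (Fin n) → ℂ} {B : ℝ} (hB : ∀ t, ‖f t‖ ≤ B)
    (k : Fin n → ℤ) : ‖mFourierCoeff f k‖ ≤ B := by
  rw [mFourierCoeff_eq]
  refine (norm_integral_le_of_norm_le_const (C := B) (Filter.Eventually.of_forall fun t => ?_)).trans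
    (by simp)
  rw [norm_mul, norm_mFourier_apply, one_mul]
  exact hB t

lemma exists_bound_torus {E : Type*} [NormedAddCommGroup E]
    {f : UnitAddTorus (Fin n) → E} (hf : Continuous f) : ∃ B, ∀ t, ‖f t‖ ≤ B := by
  obtain ⟨B, hB⟩ := isCompact_univ.exists_bound_of_continuousOn hf.continuousOn
  exact ⟨B, fun t => hB t trivial⟩

lemma continuous_fourier_series {a : (Fin n → ℤ) → ℂ} (ha : Summable fun k => ‖a k‖) :
    Continuous fun t => ∑' k, a k * mFourier k t := by
  refine continuous_tsum (fun k => continuous_const.mul (mFourier k).continuous) ha fun k t => ?_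
  rw [norm_mul, norm_mFourier_apply, mul_one]

/-- The Fourier series of a convolution. -/
lemma hasSum_convolution {a : (Fin n → ℤ) → ℂ} (ha : Summable fun k => ‖a k‖)
    {F : UnitAddTorus (Fin n) → ℂ} (hF : Continuous F) (x : UnitAddTorus (Fin n)) :
    HasSum (fun k => a k * (mFourier k x * mFourierCoeff F k))
      (∫ t, (∑' k, a k * mFourier k t) * F (x - t) ∂torusMeasure n) := by
  obtain ⟨B, hB⟩ := exists_bound_torus hF
  have hF' : Continuous fun t => F (x - t) := hF.comp (continuous_const.sub continuous_id)
  have h := hasSum_integral_of_summable_integral_norm (μ := torusMeasure n)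
    (F := fun k t => a k * (mFourier k t * F (x - t)))
    (fun k => integrable_of_continuous_torus
      (continuous_const.mul ((mFourier k).continuous.mul hF')))
    (Summable.of_nonneg_of_le (fun k => integral_nonneg fun t => norm_nonneg _) (fun k => ?_)
      (ha.mul_right B))
  · simp only [← mul_assoc, tsum_mul_right] at h
    refine h.congr_fun fun k => ?_
    rw [← integral_sub_left_eq_self _ (torusMeasure n) x, mFourierCoeff_eq, ← mul_assoc,
      ← MeasureTheory.integral_const_mul]
    simp only [mFourier_sub_apply, sub_sub_cancel, mul_assoc]
  · calc ∫ t, ‖a k * (mFourier k t * F (x - t))‖ ∂torusMeasure n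
        ≤ ∫ t, ‖a k‖ * B ∂torusMeasure n := by
          refine integral_mono_of_nonneg (Filter.Eventually.of_forall fun t => norm_nonneg _)
            (integrable_const _) (Filter.Eventually.of_forall fun t => ?_)
          simp only [norm_mul, norm_mFourier_apply, one_mul]
          exact mul_le_mul_of_nonneg_left (hB _) (norm_nonneg _)
      _ = ‖a k‖ * B := by simp

/-- A kernel solving the cohomological equation `u(x + α) - u(x) = g(x) - ∫ g` for those `g` that
are obtained from a continuous function by dividing its Fourier coefficients by the weight `P`. -/
lemma exists_kernel (α : UnitAddTorus (Fin n)) {P : (Fin n → ℤ) → ℝ} (hP0 : ∀ k, P k ≠ 0)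
    (hne : ∀ k, k ≠ 0 → mFourier k α - 1 ≠ 0) (hP : Summable fun k => |(P k)⁻¹|)
    (hs : Summable fun k => ‖(mFourier k α - 1)⁻¹ * ((P k : ℂ))⁻¹‖) :
    ∃ K : UnitAddTorus (Fin n) → ℝ, Continuous K ∧ ∀ F g : UnitAddTorus (Fin n) → ℝ,
      Continuous F → Continuous g →
      (∀ k, mFourierCoeff (fun t => (F t : ℂ)) k = P k * mFourierCoeff (fun t => (g t : ℂ)) k) →
      ∀ x, ∫ t, K t * F (x + α - t) ∂torusMeasure n - ∫ t, K t * F (x - t) ∂torusMeasure n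
        = g x - ∫ t, g t ∂torusMeasure n := by
  set a : (Fin n → ℤ) → ℂ := fun k => (mFourier k α - 1)⁻¹ * (P k : ℂ)⁻¹ with ha
  have hK := continuous_fourier_series hs
  refine ⟨fun t => (∑' k, a k * mFourier k t).re, Complex.continuous_re.comp hK, ?_⟩
  intro F g hF hg hFg x
  have hFc : Continuous fun t => (F t : ℂ) := Complex.continuous_ofReal.comp hF
  have hre : ∀ y, ∫ t, (∑' k, a k * mFourier k t).re * F (y - t) ∂torusMeasure n =
      (∫ t, (∑' k, a k * mFourier k t) * (F (y - t) : ℂ) ∂torusMeasure n).re := by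
    intro y
    have hi : Integrable (fun t => (∑' k, a k * mFourier k t) * (F (y - t) : ℂ))
        (torusMeasure n) :=
      integrable_of_continuous_torus (hK.mul (hFc.comp (continuous_const.sub continuous_id)))
    refine Eq.trans ?_ (integral_re hi)
    congr 1
    ext t
    simp
  have hsg : Summable (mFourierCoeff fun t => (g t : ℂ)) := by
    obtain ⟨B, hB⟩ := exists_bound_torus hFc
    refine Summable.of_norm_bounded (hP.mul_right B) fun k => ?_
    have e : mFourierCoeff (fun t => (g t : ℂ)) k =
        ((P k)⁻¹ : ℝ) * mFourierCoeff (fun t => (F t : ℂ)) k := by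
      rw [hFg, ← mul_assoc, ← Complex.ofReal_mul, inv_mul_cancel₀ (hP0 k), Complex.ofReal_one,
        one_mul]
    rw [e, norm_mul, Complex.norm_real]
    exact mul_le_mul_of_nonneg_left (norm_mFourierCoeff_le hB k) (norm_nonneg _)
  have hsum := (hasSum_mFourier_series_apply_of_summable
    (f := ⟨fun t => (g t : ℂ), Complex.continuous_ofReal.comp hg⟩) hsg x).sub
    (hasSum_ite_eq (0 : Fin n → ℤ) (mFourierCoeff (fun t => (g t : ℂ)) 0))
  have hdiff := (hasSum_convolution hs hFc (x + α)).sub (hasSum_convolution hs hFc x)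
  have hterm : ∀ k, a k * (mFourier k (x + α) * mFourierCoeff (fun t => (F t : ℂ)) k)
      - a k * (mFourier k x * mFourierCoeff (fun t => (F t : ℂ)) k) =
      mFourierCoeff (fun t => (g t : ℂ)) k • mFourier k x
        - if k = 0 then mFourierCoeff (fun t => (g t : ℂ)) 0 else 0 := by
    intro k
    rw [mFourier_add_apply, hFg, ha, smul_eq_mul]
    split_ifs with hk
    · subst hk
      simp [mFourier_zero]
    · have h1 := hne k hk
      have h2 : (P k : ℂ) ≠ 0 := by exact_mod_cast hP0 k
      field_simp
      ring
  have heq := hdiff.unique (hsum.congr_fun fun k => (hterm k))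
  rw [hre, hre, ← Complex.sub_re, heq]
  have h0 : mFourierCoeff (fun t => (g t : ℂ)) 0 = ((∫ t, g t ∂torusMeasure n : ℝ) : ℂ) := by
    rw [mFourierCoeff_eq, neg_zero, mFourier_zero]
    simpa using integral_ofReal (𝕜 := ℂ)
  rw [h0]
  simp

end Torus

section SmallDivisors

open UnitAddTorus

lemma summable_prod_inv : Summable fun k : Fin n → ℤ => ∏ j, (1 + (k j : ℝ) ^ 2)⁻¹ := by
  have h1 : Summable fun m : ℤ => (1 + (m : ℝ) ^ 2)⁻¹ := by
    refine Summable.of_norm_bounded_eventually (Real.summable_one_div_int_pow.2 one_lt_two) ?_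
    filter_upwards [(Set.finite_singleton (0 : ℤ)).compl_mem_cofinite] with m hm
    have hm' : (m : ℝ) ≠ 0 := by exact_mod_cast hm
    rw [Real.norm_of_nonneg (by positivity), one_div]
    exact inv_anti₀ (by positivity) (by linarith)
  refine summable_of_sum_le (c := ∏ _j : Fin n, ∑' m : ℤ, (1 + (m : ℝ) ^ 2)⁻¹)
    (fun k => Finset.prod_nonneg fun j _ => by positivity) fun s => ?_
  let T : Fin n → Finset ℤ := fun j => s.image fun k => k j
  calc ∑ k ∈ s, ∏ j, (1 + (k j : ℝ) ^ 2)⁻¹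
      ≤ ∑ k ∈ Fintype.piFinset T, ∏ j, (1 + (k j : ℝ) ^ 2)⁻¹ := by
        refine Finset.sum_le_sum_of_subset_of_nonneg (fun k hk => ?_)
          fun k _ _ => Finset.prod_nonneg fun j _ => by positivity
        exact Fintype.mem_piFinset.2 fun j => Finset.mem_image_of_mem _ hk
    _ = ∏ j, ∑ m ∈ T j, (1 + (m : ℝ) ^ 2)⁻¹ :=
        (Finset.prod_univ_sum T
          fun _ m => (1 + (m : ℝ) ^ 2)⁻¹).symm
    _ ≤ ∏ _j : Fin n, ∑' m : ℤ, (1 + (m : ℝ) ^ 2)⁻¹ :=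
        Finset.prod_le_prod (fun j _ => Finset.sum_nonneg fun m _ => by positivity)
          fun j _ => h1.sum_le_tsum _ fun m _ => by positivity

lemma one_add_sum_le_prod {ι : Type*} (s : Finset ι) {f : ι → ℝ} (hf : ∀ j, 0 ≤ f j) :
    1 + ∑ j ∈ s, f j ≤ ∏ j ∈ s, (1 + f j) := by
  classical
  induction s using Finset.induction_on with
  | empty => simp
  | insert i s hi ih =>
    rw [Finset.sum_insert hi, Finset.prod_insert hi]
    nlinarith [hf i, Finset.sum_nonneg fun j (_ : j ∈ s) => hf j]

lemma one_add_rpow_le (k : Fin n → ℤ) {τ : ℝ} (hτ : 0 < τ) :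
    1 + (∑ j, |(k j : ℝ)|) ^ τ ≤ 2 * 2 ^ (n * ⌈τ⌉₊) * ∏ j, (1 + (k j : ℝ) ^ 2) ^ ⌈τ⌉₊ := by
  set L := ⌈τ⌉₊
  set S := ∑ j, |(k j : ℝ)| with hS
  have hS0 : 0 ≤ S := Finset.sum_nonneg fun j _ => abs_nonneg _
  have h1 : S ^ τ ≤ (1 + S) ^ L := by
    calc S ^ τ ≤ (1 + S) ^ τ := Real.rpow_le_rpow hS0 (by linarith) hτ.le
      _ ≤ (1 + S) ^ (L : ℝ) := Real.rpow_le_rpow_of_exponent_le (by linarith) (Nat.le_ceil τ)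
      _ = (1 + S) ^ L := Real.rpow_natCast _ _
  have h2 : (1 : ℝ) ≤ (1 + S) ^ L := one_le_pow₀ (by linarith)
  have h3 : 1 + S ≤ ∏ j, (2 * (1 + (k j : ℝ) ^ 2)) := by
    refine (one_add_sum_le_prod Finset.univ fun j => abs_nonneg (k j : ℝ)).trans ?_
    refine Finset.prod_le_prod (fun j _ => by positivity) fun j _ => ?_
    nlinarith [sq_abs (k j : ℝ), sq_nonneg (|(k j : ℝ)| - 1)]
  have h4 : (1 + S) ^ L ≤ 2 ^ (n * L) * ∏ j, (1 + (k j : ℝ) ^ 2) ^ L := by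
    refine (pow_le_pow_left₀ (by linarith) h3 L).trans (le_of_eq ?_)
    rw [Finset.prod_mul_distrib, mul_pow, Finset.prod_pow]
    simp [pow_mul]
  linarith

/-- The point of the torus with coordinates `ω`, in units of full turns. -/
def toTorus (ω : Fin n → ℝ) : UnitAddTorus (Fin n) := fun j => (ω j : UnitAddCircle)

lemma mFourier_toTorus (k : Fin n → ℤ) (ω : Fin n → ℝ) :
    mFourier k (toTorus ω) = Complex.exp (Complex.I * ((2 * π * ∑ j, ω j * k j : ℝ) : ℂ)) := by
  simp only [mFourier, toTorus, ContinuousMap.coe_mk, fourier_coe_apply, ← Complex.exp_sum]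
  congr 1
  push_cast
  rw [Finset.mul_sum, Finset.mul_sum]
  refine Finset.sum_congr rfl fun j _ => ?_
  ring

lemma four_mul_abs_sub_round_le (y : ℝ) :
    4 * |y - round y| ≤ ‖Complex.exp (Complex.I * ((2 * π * y : ℝ) : ℂ)) - 1‖ := by
  have h := abs_sub_round y
  have hs : |Real.sin (π * y)| = |Real.sin (π * |y - round y|)| := by
    have e : π * y = π * (y - round y) + (round y : ℤ) * π := by ring
    rw [e, Real.sin_add_int_mul_pi, abs_mul, abs_zpow, abs_neg, abs_one, one_zpow, one_mul]
    rcases abs_choice (y - round y) with h | h <;> rw [h]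
    rw [mul_neg, Real.sin_neg, abs_neg]
  rw [Complex.norm_exp_I_mul_ofReal_sub_one, show 2 * π * y / 2 = π * y by ring, norm_mul,
    Real.norm_eq_abs, Real.norm_eq_abs, hs]
  have h2 := Real.mul_le_sin (x := π * |y - round y|) (by positivity) (by nlinarith [Real.pi_pos])
  rw [show 2 / π * (π * |y - round y|) = 2 * |y - round y| by field_simp] at h2
  rw [abs_of_pos (by norm_num : (0 : ℝ) < 2)]
  linarith [le_abs_self (Real.sin (π * |y - round y|))]

/-- The weight by which the Fourier coefficients are divided. -/
def fourierWeight (N : ℕ) (k : Fin n → ℤ) : ℝ := ∏ j, (1 + (k j : ℝ) ^ 2) ^ N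

lemma fourierWeight_pos (N : ℕ) (k : Fin n → ℤ) : 0 < fourierWeight N k :=
  Finset.prod_pos fun j _ => by positivity

variable {τ γ : ℝ} {ω : Fin n → ℝ}

lemma norm_divisor_ge
    (hdio : ∀ (k₀ : ℤ) (k : Fin n → ℤ), (k₀, k) ≠ 0 →
      γ / (1 + (∑ j, |(k j : ℝ)|) ^ τ) ≤ |∑ j, ω j * (k j : ℝ) + (k₀ : ℝ)|)
    {k : Fin n → ℤ} (hk : k ≠ 0) :
    4 * (γ / (1 + (∑ j, |(k j : ℝ)|) ^ τ)) ≤ ‖mFourier k (toTorus ω) - 1‖ := by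
  rw [mFourier_toTorus]
  refine le_trans ?_ (four_mul_abs_sub_round_le _)
  have := hdio (-round (∑ j, ω j * (k j : ℝ))) k fun h => hk (Prod.mk.inj h).2
  push_cast at this
  rw [← sub_eq_add_neg] at this
  linarith

lemma exists_dio_kernel (hτ : 0 < τ) (hγ : 0 < γ)
    (hdio : ∀ (k₀ : ℤ) (k : Fin n → ℤ), (k₀, k) ≠ 0 →
      γ / (1 + (∑ j, |(k j : ℝ)|) ^ τ) ≤ |∑ j, ω j * (k j : ℝ) + (k₀ : ℝ)|) :
    ∃ K : UnitAddTorus (Fin n) → ℝ, Continuous K ∧ ∀ F g : UnitAddTorus (Fin n) → ℝ,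
      Continuous F → Continuous g →
      (∀ k, mFourierCoeff (fun t => (F t : ℂ)) k =
        fourierWeight (⌈τ⌉₊ + 1) k * mFourierCoeff (fun t => (g t : ℂ)) k) →
      ∀ x, ∫ t, K t * F (x + toTorus ω - t) ∂torusMeasure n - ∫ t, K t * F (x - t) ∂torusMeasure n
        = g x - ∫ t, g t ∂torusMeasure n := by
  have hw : ∀ k : Fin n → ℤ, (fourierWeight (⌈τ⌉₊ + 1) k)⁻¹ =
      (∏ j, (1 + (k j : ℝ) ^ 2) ^ ⌈τ⌉₊)⁻¹ * ∏ j, (1 + (k j : ℝ) ^ 2)⁻¹ := fun k => by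
    rw [fourierWeight, Finset.prod_inv_distrib, ← mul_inv, ← Finset.prod_mul_distrib]
    simp only [pow_succ]
  have hA : ∀ k : Fin n → ℤ, 1 ≤ ∏ j, (1 + (k j : ℝ) ^ 2) ^ ⌈τ⌉₊ := fun k =>
    Finset.one_le_prod fun j _ => one_le_pow₀ (by nlinarith [sq_nonneg (k j : ℝ)])
  have hB : ∀ k : Fin n → ℤ, 0 ≤ ∏ j, (1 + (k j : ℝ) ^ 2)⁻¹ := fun k =>
    Finset.prod_nonneg fun j _ => by positivity
  have hpos : ∀ k : Fin n → ℤ, 0 < 4 * (γ / (1 + (∑ j, |(k j : ℝ)|) ^ τ)) := fun k => by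
    have : 0 ≤ ∑ j, |(k j : ℝ)| := Finset.sum_nonneg fun j _ => abs_nonneg _
    positivity
  refine exists_kernel (toTorus ω) (fun k => (fourierWeight_pos _ k).ne')
    (fun k hk => norm_pos_iff.1 ((hpos k).trans_le (norm_divisor_ge hdio hk))) ?_ ?_
  · refine Summable.of_nonneg_of_le (fun k => abs_nonneg _) (fun k => ?_) summable_prod_inv
    rw [abs_of_pos (inv_pos.2 (fourierWeight_pos _ k)), hw]
    exact mul_le_of_le_one_left (hB k) (inv_le_one_of_one_le₀ (hA k))
  · refine Summable.of_nonneg_of_le (fun k => norm_nonneg _) (fun k => ?_)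
      (summable_prod_inv.mul_left ((2 * 2 ^ (n * ⌈τ⌉₊)) / (4 * γ)))
    by_cases hk : k = 0
    · have h0 := hB k
      subst hk
      rw [mFourier_zero]
      simp only [ContinuousMap.one_apply, sub_self, inv_zero, zero_mul, norm_zero]
      positivity
    · rw [norm_mul, ← Complex.ofReal_inv, Complex.norm_real, norm_inv,
        Real.norm_of_nonneg (inv_nonneg.2 (fourierWeight_pos _ k).le), hw, ← mul_assoc]
      refine mul_le_mul_of_nonneg_right ?_ (hB k)
      have h1 := inv_anti₀ (hpos k) (norm_divisor_ge hdio hk)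
      have h2 := one_add_rpow_le k hτ
      have h3 := hA k
      calc _ ≤ (4 * (γ / (1 + (∑ j, |(k j : ℝ)|) ^ τ)))⁻¹ *
            (∏ j, (1 + (k j : ℝ) ^ 2) ^ ⌈τ⌉₊)⁻¹ :=
            mul_le_mul_of_nonneg_right h1 (by positivity)
        _ = (1 + (∑ j, |(k j : ℝ)|) ^ τ) / (4 * γ) * (∏ j, (1 + (k j : ℝ) ^ 2) ^ ⌈τ⌉₊)⁻¹ := by
            rw [mul_div_assoc', inv_div]
        _ ≤ (2 * 2 ^ (n * ⌈τ⌉₊) * ∏ j, (1 + (k j : ℝ) ^ 2) ^ ⌈τ⌉₊) / (4 * γ) *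
            (∏ j, (1 + (k j : ℝ) ^ 2) ^ ⌈τ⌉₊)⁻¹ := by gcongr
        _ = _ := by field_simp

end SmallDivisors

section Lift

open UnitAddTorus

/-- The point of the torus with given angles. -/
def proj (φ : Fin n → ℝ) : UnitAddTorus (Fin n) := toTorus ((2 * π)⁻¹ • φ)

/-- The angles in `(0, 2π]` of a point of the torus. -/
def ang (t : UnitAddTorus (Fin n)) : Fin n → ℝ :=
  (2 * π) • fun j => (AddCircle.equivIoc 1 0 (t j) : ℝ)

lemma proj_ang (t : UnitAddTorus (Fin n)) : proj (ang t) = t := by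
  have h : (2 * π) ≠ 0 := by positivity
  rw [proj, ang, inv_smul_smul₀ h]
  ext j
  exact AddCircle.coe_equivIoc

lemma proj_add (φ ψ : Fin n → ℝ) : proj (φ + ψ) = proj φ + proj ψ := by
  ext j
  simp [proj, toTorus, mul_add]

lemma proj_neg (φ : Fin n → ℝ) : proj (-φ) = -proj φ := by
  ext j
  simp [proj, toTorus]

lemma proj_two_pi_smul (ω : Fin n → ℝ) : proj ((2 * π) • ω) = toTorus ω := by
  rw [proj, inv_smul_smul₀ (by positivity)]

lemma isQuotientMap_proj : Topology.IsQuotientMap (proj : (Fin n → ℝ) → UnitAddTorus (Fin n)) := by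
  have h1 : IsOpenQuotientMap (toTorus : (Fin n → ℝ) → UnitAddTorus (Fin n)) :=
    IsOpenQuotientMap.piMap (f := fun _ : Fin n => ((↑) : ℝ → UnitAddCircle))
      fun _ => QuotientAddGroup.isOpenQuotientMap_mk
  exact h1.isQuotientMap.comp
    (Homeomorph.smulOfNeZero (2 * π)⁻¹ (by positivity : (2 * π)⁻¹ ≠ 0)).isQuotientMap

lemma measurable_ang : Measurable (ang : UnitAddTorus (Fin n) → Fin n → ℝ) := by
  have h : Measurable fun t : UnitAddTorus (Fin n) =>
      fun j => (AddCircle.equivIoc 1 0 (t j) : ℝ) :=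
    measurable_pi_lambda _ fun j => measurable_subtype_coe.comp
      ((AddCircle.measurableEquivIoc 1 0).measurable.comp (measurable_pi_apply j))
  exact h.const_smul (2 * π)

lemma ang_mem (t : UnitAddTorus (Fin n)) : ang t ∈ Set.Icc 0 (fun _ => 2 * π) := by
  have h : 0 < 2 * π := by positivity
  refine ⟨fun j => ?_, fun j => ?_⟩
  · exact mul_nonneg h.le (AddCircle.equivIoc 1 0 (t j)).2.1.le
  · exact mul_le_of_le_one_right h.le
      ((AddCircle.equivIoc 1 0 (t j)).2.2.trans_eq (zero_add 1))

/-- `2π`-periodicity in each angle. -/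
def AngPeriodic (f : PhaseSpace n → ℝ) : Prop :=
  ∀ j, Function.Periodic f ((2 * π) • eAng j)

lemma AngPeriodic.eq_of_proj_eq {f : PhaseSpace n → ℝ} (hf : AngPeriodic f) {φ ψ : Fin n → ℝ}
    (h : proj φ = proj ψ) (z : ℝ × ℝ) : f (φ, z) = f (ψ, z) := by
  have hm : ∀ j, ∃ m : ℤ, φ j - ψ j = m * (2 * π) := by
    intro j
    have hj := sub_eq_zero.2 (congrFun h j)
    simp only [proj, toTorus, Pi.smul_apply, smul_eq_mul] at hj
    rw [← AddCircle.coe_sub, AddCircle.coe_eq_zero_iff] at hj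
    obtain ⟨m, hm⟩ := hj
    refine ⟨m, ?_⟩
    rw [zsmul_eq_mul, mul_one, ← mul_sub] at hm
    rw [hm]
    field_simp
  choose m hm using hm
  have hs : ∀ (s : Finset (Fin n)) (q : PhaseSpace n),
      f (q + ∑ j ∈ s, m j • ((2 * π) • eAng j)) = f q := by
    intro s
    induction s using Finset.induction_on with
    | empty => simp
    | insert i s hi ih =>
      intro q
      rw [Finset.sum_insert hi, add_comm (m i • _), ← add_assoc, (hf i).zsmul, ih]
  rw [← hs Finset.univ (ψ, z)]
  congr 1
  refine Prod.ext ?_ ?_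
  · ext i
    rw [Prod.fst_add, Prod.fst_sum, Pi.add_apply, Finset.sum_apply]
    simp only [eAng, Prod.smul_mk, Pi.smul_apply, Pi.single_apply]
    simp [← hm i]
  · rw [Prod.snd_add, Prod.snd_sum]
    simp [eAng]

/-- The function on the torus obtained from a function of the angles. -/
def lift (f : PhaseSpace n → ℝ) (z : ℝ × ℝ) (t : UnitAddTorus (Fin n)) : ℝ := f (ang t, z)

lemma AngPeriodic.lift_proj {f : PhaseSpace n → ℝ} (hf : AngPeriodic f) (φ : Fin n → ℝ)
    (z : ℝ × ℝ) : lift f z (proj φ) = f (φ, z) :=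
  hf.eq_of_proj_eq (proj_ang _) z

lemma AngPeriodic.continuous_lift {f : PhaseSpace n → ℝ} (hf : AngPeriodic f) (hc : Continuous f)
    (z : ℝ × ℝ) : Continuous (lift f z) := by
  rw [isQuotientMap_proj.continuous_iff]
  have : lift f z ∘ proj = fun φ => f (φ, z) := funext fun φ => hf.lift_proj φ z
  rw [this]
  fun_prop

lemma AngPeriodic.lift_add {f : PhaseSpace n → ℝ} (hf : AngPeriodic f) (φ : Fin n → ℝ)
    (z : ℝ × ℝ) (t : UnitAddTorus (Fin n)) : f (φ + ang t, z) = lift f z (t + proj φ) := by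
  rw [← hf.lift_proj, proj_add, proj_ang, add_comm]

lemma AngPeriodic.lift_sub {f : PhaseSpace n → ℝ} (hf : AngPeriodic f) (φ : Fin n → ℝ)
    (z : ℝ × ℝ) (t : UnitAddTorus (Fin n)) : f (φ - ang t, z) = lift f z (proj φ - t) := by
  rw [← hf.lift_proj, sub_eq_add_neg, proj_add, proj_neg, proj_ang, ← sub_eq_add_neg]

lemma fderiv_add_period {f : PhaseSpace n → ℝ} {v : PhaseSpace n} (hf : Function.Periodic f v)
    (q : PhaseSpace n) : fderiv ℝ f (q + v) = fderiv ℝ f q := by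
  rw [← fderiv_comp_add_right, show (fun q => f (q + v)) = f from funext hf]

lemma AngPeriodic.dirDeriv {f : PhaseSpace n → ℝ} (hf : AngPeriodic f) (w : PhaseSpace n) :
    AngPeriodic (dirDeriv w f) := fun j q => by
  simp only [PhaseSpace.dirDeriv, fderiv_add_period (hf j)]

lemma AngPeriodic.euler {f : PhaseSpace n → ℝ} (hf : AngPeriodic f) :
    AngPeriodic (euler f) := fun j q => by
  simp only [PhaseSpace.euler, fderiv_add_period (hf j)]
  simp [eAng]

lemma AngPeriodic.sub {f g : PhaseSpace n → ℝ} (hf : AngPeriodic f) (hg : AngPeriodic g) :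
    AngPeriodic (f - g) := fun j q => by
  simp only [Pi.sub_apply, hf j q, hg j q]

lemma mFourier_proj_single (k : Fin n → ℤ) (j : Fin n) (h : ℝ) :
    mFourier k (proj (h • Pi.single j 1)) = Complex.exp (h * (Complex.I * k j)) := by
  rw [proj, mFourier_toTorus]
  congr 1
  have : (2 * π * ∑ i, ((2 * π)⁻¹ • h • (Pi.single j 1 : Fin n → ℝ)) i * k i : ℝ) = h * k j := by
    simp [Pi.single_apply]
    field_simp
  rw [this]
  push_cast
  ring

lemma mFourierCoeff_translate (G : UnitAddTorus (Fin n) → ℂ) (a : UnitAddTorus (Fin n))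
    (k : Fin n → ℤ) :
    ∫ t, mFourier (-k) t * G (t + a) ∂torusMeasure n = mFourier k a * mFourierCoeff G k := by
  have h : ∀ t, mFourier (-k) t * G (t + a) =
      mFourier k a * (mFourier (-k) (t + a) * G (t + a)) := by
    intro t
    rw [mFourier_add_apply, mFourier_neg (x := a), ← mul_assoc, ← mul_assoc]
    congr 1
    rw [mul_right_comm, Complex.mul_conj, Complex.normSq_eq_norm_sq, norm_mFourier_apply]
    simp
  simp only [h]
  rw [MeasureTheory.integral_const_mul, mFourierCoeff_eq,
    integral_add_right_eq_self (fun t => mFourier (-k) t * G t) a]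

lemma continuous_mFourier_mul_lift {f : PhaseSpace n → ℝ} (hf : AngPeriodic f) (hc : Continuous f)
    (z : ℝ × ℝ) (φ : Fin n → ℝ) (k : Fin n → ℤ) :
    Continuous fun t => mFourier (-k) t * ((f (φ + ang t, z) : ℝ) : ℂ) := by
  simp only [hf.lift_add]
  exact (mFourier (-k)).continuous.mul (Complex.continuous_ofReal.comp
    ((hf.continuous_lift hc z).comp (continuous_id.add continuous_const)))

lemma hasDerivAt_translate {f : PhaseSpace n → ℝ} (hs : ContDiff ℝ (⊤ : ℕ∞) f)
    (φ : Fin n → ℝ) (z : ℝ × ℝ) (j : Fin n) (h : ℝ) :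
    HasDerivAt (fun h : ℝ => f (h • Pi.single j 1 + φ, z))
      (dirDeriv (eAng j) f (h • Pi.single j 1 + φ, z)) h := by
  have hl : HasDerivAt (fun h : ℝ => ((h • Pi.single j 1 + φ, z) : PhaseSpace n)) (eAng j) h := by
    have := (((hasDerivAt_id h).smul_const (Pi.single j 1 : Fin n → ℝ)).add_const
      φ).prodMk (hasDerivAt_const h z)
    rw [one_smul] at this
    exact this
  exact ((differentiable_of_smooth hs _).hasFDerivAt).comp_hasDerivAt h hl

lemma hasDerivAt_integral_translate {f : PhaseSpace n → ℝ} (hf : AngPeriodic f)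
    (hs : ContDiff ℝ (⊤ : ℕ∞) f) (z : ℝ × ℝ) (j : Fin n) (k : Fin n → ℤ) :
    HasDerivAt (fun h : ℝ => ∫ t, mFourier (-k) t * ((f (h • Pi.single j 1 + ang t, z) : ℝ) : ℂ)
      ∂torusMeasure n)
      (∫ t, mFourier (-k) t * ((dirDeriv (eAng j) f ((0 : ℝ) • Pi.single j 1 + ang t, z) : ℝ) : ℂ)
        ∂torusMeasure n) 0 := by
  have hs' := (contDiff_dirDeriv hs (eAng j)).continuous
  obtain ⟨D, hD⟩ := ((isCompact_Icc (a := (0 : Fin n → ℝ)) (b := fun _ => 2 * π)).prod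
    (isCompact_closedBall (0 : ℝ) 1)).exists_bound_of_continuousOn
    (f := fun r : (Fin n → ℝ) × ℝ => dirDeriv (eAng j) f (r.2 • Pi.single j 1 + r.1, z))
    (by fun_prop)
  have hm (h : ℝ) := continuous_mFourier_mul_lift hf hs.continuous z (h • Pi.single j 1) k
  have hm' := continuous_mFourier_mul_lift (hf.dirDeriv (eAng j)) hs' z ((0 : ℝ) • Pi.single j 1) k
  have hb : ∀ t, ∀ h ∈ Metric.closedBall (0 : ℝ) 1, ‖mFourier (-k) t *
      ((dirDeriv (eAng j) f (h • Pi.single j 1 + ang t, z) : ℝ) : ℂ)‖ ≤ D := by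
    intro t h hh
    rw [norm_mul, norm_mFourier_apply, one_mul, Complex.norm_real]
    exact hD (ang t, h) ⟨ang_mem t, hh⟩
  have hd : ∀ t, ∀ h ∈ Metric.closedBall (0 : ℝ) 1,
      HasDerivAt (fun h : ℝ => mFourier (-k) t * ((f (h • Pi.single j 1 + ang t, z) : ℝ) : ℂ))
        (mFourier (-k) t * ((dirDeriv (eAng j) f (h • Pi.single j 1 + ang t, z) : ℝ) : ℂ)) h :=
    fun t h _ => ((hasDerivAt_translate hs (ang t) z j h).ofReal_comp).const_mul _
  exact (hasDerivAt_integral_of_dominated_loc_of_deriv_le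
    (Metric.closedBall_mem_nhds _ one_pos)
    (Filter.Eventually.of_forall fun h => (hm h).aestronglyMeasurable)
    (integrable_of_continuous_torus (hm 0)) hm'.aestronglyMeasurable
    (Filter.Eventually.of_forall hb) (integrable_const D) (Filter.Eventually.of_forall hd)).2

/-- Fourier coefficients of a partial derivative. -/
lemma mFourierCoeff_dirDeriv {f : PhaseSpace n → ℝ} (hf : AngPeriodic f)
    (hs : ContDiff ℝ (⊤ : ℕ∞) f) (z : ℝ × ℝ) (j : Fin n) (k : Fin n → ℤ) :
    mFourierCoeff (fun t => (lift (dirDeriv (eAng j) f) z t : ℂ)) k =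
      Complex.I * k j * mFourierCoeff (fun t => (lift f z t : ℂ)) k := by
  have hI : ∀ h : ℝ, ∫ t, mFourier (-k) t * ((f (h • Pi.single j 1 + ang t, z) : ℝ) : ℂ)
      ∂torusMeasure n =
      Complex.exp (h * (Complex.I * k j)) * mFourierCoeff (fun t => (lift f z t : ℂ)) k := by
    intro h
    simp only [hf.lift_add, ← mFourier_proj_single]
    exact mFourierCoeff_translate (fun t => (lift f z t : ℂ)) _ k
  have h1 := hasDerivAt_integral_translate hf hs z j k
  simp only [hI, zero_smul, zero_add] at h1
  have h2 : HasDerivAt (fun h : ℝ => Complex.exp (h * (Complex.I * k j)) *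
      mFourierCoeff (fun t => (lift f z t : ℂ)) k)
      (Complex.I * k j * mFourierCoeff (fun t => (lift f z t : ℂ)) k) 0 := by
    have := ((((hasDerivAt_id (0 : ℝ)).ofReal_comp).mul_const (Complex.I * k j)).cexp).mul_const
      (mFourierCoeff (fun t => (lift f z t : ℂ)) k)
    simpa using this
  exact (mFourierCoeff_eq _ _).trans (h1.unique h2)

end Lift

section Sieve

open UnitAddTorus

/-- A symbol which is periodic in the angles. -/
structure PeriodicSymb (a b : ℝ) (f : PhaseSpace n → ℝ) : Prop where
  symb : Symb a b f
  per : AngPeriodic f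

variable {a b : ℝ} {f g : PhaseSpace n → ℝ}

lemma PeriodicSymb.smooth (hf : PeriodicSymb a b f) : ContDiff ℝ (⊤ : ℕ∞) f := hf.symb.contDiff

lemma PeriodicSymb.continuous (hf : PeriodicSymb a b f) : Continuous f := hf.smooth.continuous

lemma PeriodicSymb.ang (hf : PeriodicSymb a b f) (j : Fin n) :
    PeriodicSymb a b (dirDeriv (eAng j) f) := ⟨hf.symb.ang j, hf.per.dirDeriv _⟩

lemma PeriodicSymb.euler (hf : PeriodicSymb a b f) : PeriodicSymb a b (euler f) :=
  ⟨hf.symb.euler, hf.per.euler⟩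

lemma PeriodicSymb.sub (hf : PeriodicSymb a b f) (hg : PeriodicSymb a b g) :
    PeriodicSymb a b (f - g) :=
  ⟨fun N => (hf.symb N).sub (hg.symb N), hf.per.sub hg.per⟩

lemma dirDeriv_sub (hf : Differentiable ℝ f) (hg : Differentiable ℝ g)
    (w : PhaseSpace n) : dirDeriv w (f - g) = dirDeriv w f - dirDeriv w g := by
  ext q
  simp [dirDeriv, fderiv_sub (hf q) (hg q)]

lemma euler_sub (hf : Differentiable ℝ f) (hg : Differentiable ℝ g) :
    euler (f - g) = euler f - euler g := by
  ext q
  simp [euler, fderiv_sub (hf q) (hg q)]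

lemma euler_dirDeriv_ang (hf : ContDiff ℝ (⊤ : ℕ∞) f) (j : Fin n) :
    euler (dirDeriv (eAng j) f) = dirDeriv (eAng j) (euler f) := by
  have h1 := differentiable_of_smooth (contDiff_dirDeriv hf ePos)
  have h2 := differentiable_of_smooth (contDiff_dirDeriv hf eMom)
  have hx : Differentiable ℝ fun q : PhaseSpace n => q.2.1 := by fun_prop
  have hξ : Differentiable ℝ fun q : PhaseSpace n => q.2.2 := by fun_prop
  have ex : dirDeriv (eAng j) (fun q : PhaseSpace n => q.2.1) = 0 := by
    ext q
    rw [dirDeriv, fderiv.fst (by fun_prop), fderiv_snd]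
    simp [eAng]
  have eξ : dirDeriv (eAng j) (fun q : PhaseSpace n => q.2.2) = 0 := by
    ext q
    rw [dirDeriv, fderiv.snd (by fun_prop), fderiv_snd]
    simp [eAng]
  rw [euler_eq, euler_eq, dirDeriv_add (hx.mul h1) (hξ.mul h2), dirDeriv_mul hx h1,
    dirDeriv_mul hξ h2, ex, eξ, dirDeriv_comm hf, dirDeriv_comm hf eMom]
  simp

/-- The Helmholtz operator `1 - ∂_{φ_j}²`. -/
def helm (j : Fin n) (f : PhaseSpace n → ℝ) : PhaseSpace n → ℝ :=
  f - dirDeriv (eAng j) (dirDeriv (eAng j) f)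

/-- The operator `∏_j (1 - ∂_{φ_j}²)^N` over a list of angles. -/
def sieveList (N : ℕ) (l : List (Fin n)) (f : PhaseSpace n → ℝ) : PhaseSpace n → ℝ :=
  l.foldr (fun j g => (helm j)^[N] g) f

/-- The operator `∏_j (1 - ∂_{φ_j}²)^N`. -/
def sieve (N : ℕ) (f : PhaseSpace n → ℝ) : PhaseSpace n → ℝ := sieveList N (List.finRange n) f

/-- A class of functions stable under every `helm j` is stable under `sieve N`. -/
lemma sieve_induction {P : (PhaseSpace n → ℝ) → Prop} (hP : ∀ f, P f → ∀ j, P (helm j f))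
    (N : ℕ) (hf : P f) : P (sieve N f) := by
  have hi : ∀ (j : Fin n) (k : ℕ) {f}, P f → P ((helm j)^[k] f) := by
    intro j k
    induction k with
    | zero => exact id
    | succ k ih => exact fun hf => ih (hP _ hf j)
  unfold sieve
  induction List.finRange n with
  | nil => exact hf
  | cons j l ih => exact hi j N ih

lemma PeriodicSymb.sieve (hf : PeriodicSymb a b f) (N : ℕ) : PeriodicSymb a b (sieve N f) :=
  sieve_induction (fun _ h j => h.sub ((h.ang j).ang j)) N hf

lemma contDiff_helm (hf : ContDiff ℝ (⊤ : ℕ∞) f) (j : Fin n) : ContDiff ℝ (⊤ : ℕ∞) (helm j f) :=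
  hf.sub (contDiff_dirDeriv (contDiff_dirDeriv hf _) _)

/-- An operator which commutes with the angular derivatives commutes with `sieve N`. -/
lemma sieve_comm {T : (PhaseSpace n → ℝ) → PhaseSpace n → ℝ}
    (hsub : ∀ {f g}, ContDiff ℝ (⊤ : ℕ∞) f → ContDiff ℝ (⊤ : ℕ∞) g → T (f - g) = T f - T g)
    (hcomm : ∀ {f} (j : Fin n), ContDiff ℝ (⊤ : ℕ∞) f →
      T (dirDeriv (eAng j) f) = dirDeriv (eAng j) (T f))
    (N : ℕ) (hf : ContDiff ℝ (⊤ : ℕ∞) f) : T (sieve N f) = sieve N (T f) := by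
  have h1 : ∀ {f} (j : Fin n), ContDiff ℝ (⊤ : ℕ∞) f → T (helm j f) = helm j (T f) := by
    intro f j hf
    have hf' := contDiff_dirDeriv hf (eAng j)
    rw [helm, hsub hf (contDiff_dirDeriv hf' _), hcomm j hf', hcomm j hf, helm]
  have h2 : ∀ (j : Fin n) (k : ℕ) {f}, ContDiff ℝ (⊤ : ℕ∞) f →
      ContDiff ℝ (⊤ : ℕ∞) ((helm j)^[k] f) ∧ T ((helm j)^[k] f) = (helm j)^[k] (T f) := by
    intro j k
    induction k with
    | zero => exact fun hf => ⟨hf, rfl⟩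
    | succ k ih =>
      intro f hf
      obtain ⟨h3, h4⟩ := ih (contDiff_helm hf j)
      exact ⟨h3, by rw [Function.iterate_succ_apply, h4, h1 j hf, Function.iterate_succ_apply]⟩
  have h5 : ∀ l : List (Fin n), ContDiff ℝ (⊤ : ℕ∞) (sieveList N l f) ∧
      T (sieveList N l f) = sieveList N l (T f) := by
    intro l
    induction l with
    | nil => exact ⟨hf, rfl⟩
    | cons j l ih =>
      refine ⟨(h2 j N ih.1).1, ?_⟩
      rw [sieveList, List.foldr_cons]
      exact ((h2 j N ih.1).2).trans (congrArg _ ih.2)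
  exact (h5 _).2

lemma sieve_dirDeriv_ang (hf : ContDiff ℝ (⊤ : ℕ∞) f) (j : Fin n) (N : ℕ) :
    dirDeriv (eAng j) (sieve N f) = sieve N (dirDeriv (eAng j) f) :=
  sieve_comm (fun h h' => dirDeriv_sub (differentiable_of_smooth h) (differentiable_of_smooth h') _)
    (fun _ h => dirDeriv_comm h _ _) N hf

lemma sieve_euler (hf : ContDiff ℝ (⊤ : ℕ∞) f) (N : ℕ) : euler (sieve N f) = sieve N (euler f) :=
  sieve_comm
    (fun h h' => euler_sub (differentiable_of_smooth h) (differentiable_of_smooth h'))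
    (fun i h => euler_dirDeriv_ang h i) N hf

lemma mFourierCoeff_helm (hf : PeriodicSymb a b f) (z : ℝ × ℝ) (j : Fin n) (k : Fin n → ℤ) :
    mFourierCoeff (fun t => (lift (helm j f) z t : ℂ)) k =
      (1 + (k j : ℂ) ^ 2) * mFourierCoeff (fun t => (lift f z t : ℂ)) k := by
  have hi : ∀ {g : PhaseSpace n → ℝ}, PeriodicSymb a b g →
      Integrable (fun t => mFourier (-k) t * (lift g z t : ℂ)) (torusMeasure n) := fun hg =>
    integrable_of_continuous_torus ((mFourier (-k)).continuous.mul
      (Complex.continuous_ofReal.comp (hg.per.continuous_lift hg.continuous z)))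
  have h1 : mFourierCoeff (fun t => (lift (helm j f) z t : ℂ)) k =
      mFourierCoeff (fun t => (lift f z t : ℂ)) k -
      mFourierCoeff (fun t => (lift (dirDeriv (eAng j) (dirDeriv (eAng j) f)) z t : ℂ)) k := by
    simp only [mFourierCoeff_eq]
    rw [← integral_sub (hi hf) (hi ((hf.ang j).ang j))]
    congr 1
    ext t
    simp only [lift, helm, Pi.sub_apply]
    push_cast
    ring
  rw [h1, mFourierCoeff_dirDeriv (hf.ang j).per (hf.ang j).smooth,
    mFourierCoeff_dirDeriv hf.per hf.smooth]
  linear_combination (-(k j : ℂ) ^ 2 * mFourierCoeff (fun t => (lift f z t : ℂ)) k) * Complex.I_sq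

lemma mFourierCoeff_sieve (hf : PeriodicSymb a b f) (z : ℝ × ℝ) (N : ℕ) (k : Fin n → ℤ) :
    mFourierCoeff (fun t => (lift (sieve N f) z t : ℂ)) k =
      fourierWeight N k * mFourierCoeff (fun t => (lift f z t : ℂ)) k := by
  have hi : ∀ (j : Fin n) (m : ℕ) {f : PhaseSpace n → ℝ}, PeriodicSymb a b f →
      PeriodicSymb a b ((helm j)^[m] f) ∧
      mFourierCoeff (fun t => (lift ((helm j)^[m] f) z t : ℂ)) k =
      (1 + (k j : ℂ) ^ 2) ^ m * mFourierCoeff (fun t => (lift f z t : ℂ)) k := by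
    intro j m
    induction m with
    | zero => exact fun hf => ⟨hf, by simp⟩
    | succ m ih =>
      intro f hf
      obtain ⟨h1, h2⟩ := ih (hf.sub ((hf.ang j).ang j))
      refine ⟨h1, h2.trans ?_⟩
      rw [pow_succ (1 + _) m, mul_assoc, ← mFourierCoeff_helm hf]
      rfl
  have hl : ∀ l : List (Fin n), PeriodicSymb a b (sieveList N l f) ∧
      mFourierCoeff (fun t => (lift (sieveList N l f) z t : ℂ)) k =
      (l.map fun j => (1 + (k j : ℂ) ^ 2) ^ N).prod *
        mFourierCoeff (fun t => (lift f z t : ℂ)) k := by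
    intro l
    induction l with
    | nil => exact ⟨hf, by simp [sieveList]⟩
    | cons j l ih =>
      obtain ⟨h1, h2⟩ := hi j N ih.1
      refine ⟨h1, h2.trans ?_⟩
      rw [ih.2, List.map_cons, List.prod_cons, mul_assoc]
  rw [sieve, (hl _).2, fourierWeight, ← Fin.prod_univ_def]
  push_cast
  rfl

end Sieve

section Flow

open UnitAddTorus

/-- The product of the torus with one period of the rotation flow. -/
def flowMeasure (n : ℕ) : Measure (UnitAddTorus (Fin n) × ℝ) :=
  (torusMeasure n).prod (volume.restrict (Set.Ioc 0 (2 * π)))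

instance : IsFiniteMeasure (flowMeasure n) := by
  unfold flowMeasure
  infer_instance

/-- Translation by an angle followed by the flow of the frequencies and of the rotation. -/
def flowMap (ω : Fin n → ℝ) (y : UnitAddTorus (Fin n) × ℝ) : (Fin n → ℝ) × ℝ :=
  (y.2 • ω - ang y.1, y.2)

/-- A kernel on the torus corrected by a multiple of the flow time. -/
def flowKernel (K : UnitAddTorus (Fin n) → ℝ) (β : ℝ) (y : UnitAddTorus (Fin n) × ℝ) : ℝ :=
  K y.1 + β * y.2

variable {ω : Fin n → ℝ} {K : UnitAddTorus (Fin n) → ℝ} {f : PhaseSpace n → ℝ} {a b : ℝ}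

lemma admissible_flow (hK : Continuous K) (β : ℝ) (ω : Fin n → ℝ) :
    Admissible (flowMeasure n) (flowMap ω) (flowKernel K β) := by
  have hs : ∀ᵐ y ∂flowMeasure n, y.2 ∈ Set.Ioc 0 (2 * π) :=
    Measure.quasiMeasurePreserving_snd.ae (ae_restrict_mem measurableSet_Ioc)
  have hang : Measurable fun y : UnitAddTorus (Fin n) × ℝ => ang y.1 :=
    measurable_ang.comp measurable_fst
  refine ⟨((measurable_snd.smul_const ω).sub hang).prodMk measurable_snd,
    (hK.measurable.comp measurable_fst).add (measurable_snd.const_mul β), ?_, ?_⟩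
  · refine ⟨(fun r : (Fin n → ℝ) × ℝ => (r.2 • ω - r.1, r.2)) ''
      (Set.Icc 0 (fun _ => 2 * π) ×ˢ Set.Icc 0 (2 * π)),
      (isCompact_Icc.prod isCompact_Icc).image (by fun_prop), ?_⟩
    filter_upwards [hs] with y hy
    exact ⟨(ang y.1, y.2), ⟨ang_mem _, Set.Ioc_subset_Icc_self hy⟩, rfl⟩
  · obtain ⟨B, hB⟩ := exists_bound_torus hK
    refine ⟨B + |β| * (2 * π), ?_⟩
    filter_upwards [hs] with y hy
    refine (abs_add_le _ _).trans (add_le_add (hB _) ?_)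
    rw [abs_mul]
    gcongr
    exact (abs_of_pos hy.1).trans_le hy.2

lemma hasDerivAt_act_flow (hf : Differentiable ℝ f) (ω ψ : Fin n → ℝ) (q : PhaseSpace n) (s : ℝ) :
    HasDerivAt (fun s => f (act (s • ω - ψ, s) q))
      (fderiv ℝ f (act (s • ω - ψ, s) q) (rot s (ω, q.2.2, -q.2.1))) s := by
  have h : HasDerivAt (fun s => act (s • ω - ψ, s) q) (rot s (ω, q.2.2, -q.2.1)) s := by
    simp only [act_eq, rot_apply]
    have h1 : HasDerivAt (fun s : ℝ => q.1 + (s • ω - ψ)) ω s := by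
      simpa using (((hasDerivAt_id s).smul_const ω).sub_const ψ).const_add q.1
    refine h1.prodMk (HasDerivAt.prodMk ?_ ?_)
    · exact (((Real.hasDerivAt_cos s).const_mul q.2.1).add
        ((Real.hasDerivAt_sin s).const_mul q.2.2)).congr_deriv (by ring)
    · exact (((Real.hasDerivAt_cos s).const_mul q.2.2).sub
        ((Real.hasDerivAt_sin s).const_mul q.2.1)).congr_deriv (by ring)
  exact (hf _).hasFDerivAt.comp_hasDerivAt s h

/-- Integration by parts along the flow. -/
lemma integral_flow_by_parts (hf : PeriodicSymb a b f) (c β : ℝ) (ω : Fin n → ℝ)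
    (q : PhaseSpace n) (t : UnitAddTorus (Fin n)) :
    ∫ s in Set.Ioc 0 (2 * π), (c + β * s) *
      fderiv ℝ f (act (s • ω - ang t, s) q) (rot s (ω, q.2.2, -q.2.1)) =
    (c + β * (2 * π)) * lift f q.2 (proj q.1 + toTorus ω - t) - c * lift f q.2 (proj q.1 - t) -
      ∫ s in Set.Ioc 0 (2 * π), β * f (act (s • ω - ang t, s) q) := by
  have h2π : (0 : ℝ) ≤ 2 * π := by positivity
  have hc : Continuous fun s : ℝ => act (s • ω - ang t, s) q :=
    continuous_act.comp (f := fun s : ℝ => (((s • ω - ang t, s) : (Fin n → ℝ) × ℝ), q))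
      (by fun_prop)
  have hd : Continuous fun s : ℝ =>
      fderiv ℝ f (act (s • ω - ang t, s) q) (rot s (ω, q.2.2, -q.2.1)) :=
    ((hf.smooth.continuous_fderiv (by simp)).comp hc).clm_apply
      (continuous_rot.clm_apply continuous_const)
  have hu : ∀ s ∈ Set.uIcc 0 (2 * π), HasDerivAt (fun s => c + β * s) β s := fun s _ => by
    simpa using ((hasDerivAt_id s).const_mul β).const_add c
  have h := integral_mul_deriv_eq_deriv_mul hu
    (fun s _ => hasDerivAt_act_flow hf.symb.differentiable ω (ang t) q s)
    intervalIntegrable_const (hd.intervalIntegrable _ _)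
  rw [← integral_of_le h2π, ← integral_of_le h2π, h]
  have e1 : act ((2 * π) • ω - ang t, 2 * π) q = (q.1 + (2 * π) • ω - ang t, q.2) := by
    rw [act_eq]
    simp [add_sub_assoc]
  have e2 : act ((0 : ℝ) • ω - ang t, 0) q = (q.1 - ang t, q.2) := by
    rw [act_eq]
    simp [sub_eq_add_neg]
  rw [e1, e2, hf.per.lift_sub, hf.per.lift_sub, proj_add, proj_two_pi_smul, mul_zero, add_zero]

/-- The derivative along the flow of a flow average. -/
lemma flow_transport (hf : PeriodicSymb a b f) (hK : Continuous K) (β : ℝ) (ω : Fin n → ℝ)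
    (q : PhaseSpace n) :
    rotGen (transport (flowMeasure n) (flowMap ω) (flowKernel K β) f) q +
      ∑ j, ω j * dirDeriv (eAng j) (transport (flowMeasure n) (flowMap ω) (flowKernel K β) f) q =
    ∫ t, (K t + β * (2 * π)) * lift f q.2 (proj q.1 + toTorus ω - t) ∂torusMeasure n -
      ∫ t, K t * lift f q.2 (proj q.1 - t) ∂torusMeasure n -
      transport (flowMeasure n) (flowMap ω) (flowKernel (fun _ => β) 0) f q := by
  have hA := admissible_flow hK β ω
  have hB := transport_integrable (admissible_flow (K := fun _ => β) continuous_const 0 ω)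
    hf.continuous q
  have hI := hA.integrable (Φ := fun r => fderiv ℝ f (act r.1 r.2)
    (rot r.1.2 (ω, q.2.2, -q.2.1))) (((hf.smooth.continuous_fderiv (by simp)).comp
      continuous_act).clm_apply
      ((continuous_rot.comp (by fun_prop)).clm_apply continuous_const)) q
  have hl := hf.per.continuous_lift hf.continuous q.2
  simp only [smul_eq_mul, flowMap, flowKernel, zero_mul, add_zero] at hI hB
  rw [← fderiv_flow, fderiv_transport hA hf.smooth]
  simp only [transport, flowMap, flowKernel, zero_mul, add_zero]
  rw [flowMeasure] at hI hB ⊢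
  rw [integral_prod _ hI, integral_prod _ hB]
  simp only [integral_flow_by_parts hf]
  rw [MeasureTheory.integral_sub, MeasureTheory.integral_sub]
  · exact integrable_of_continuous_torus (by fun_prop)
  · exact integrable_of_continuous_torus (by fun_prop)
  · exact (integrable_of_continuous_torus (by fun_prop)).sub
      (integrable_of_continuous_torus (by fun_prop))
  · exact hB.integral_prod_left

end Flow

section Average

open UnitAddTorus
open scoped Pointwise

variable {f : PhaseSpace n → ℝ} {a b : ℝ}

lemma two_pi_smul_pi_Ioc :
    (2 * π) • {x : Fin n → ℝ | ∀ i, x i ∈ Set.Ioc (0 : ℝ) (0 + 1)} =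
      Set.univ.pi fun _ => Set.Ioc 0 (2 * π) := by
  have h : 0 < 2 * π := by positivity
  ext x
  simp only [Set.mem_smul_set_iff_inv_smul_mem₀ h.ne', Set.mem_univ_pi, Set.mem_ofPred_eq, Set.mem_Ioc,
    Pi.smul_apply, smul_eq_mul, zero_add, inv_mul_le_one₀ h, inv_pos.2 h, mul_pos_iff_of_pos_left]

lemma integral_lift (hf : AngPeriodic f) (z : ℝ × ℝ) :
    ∫ t, lift f z t ∂torusMeasure n = ((2 * π) ^ n)⁻¹ *
      ∫ φ in Set.univ.pi fun _ => Set.Icc 0 (2 * π), f (φ, z) := by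
  have h1 : ∫ t, lift f z t ∂torusMeasure n =
      ∫ x in {x : Fin n → ℝ | ∀ i, x i ∈ Set.Ioc (0 : ℝ) (0 + 1)}, f ((2 * π) • x, z) := by
    refine (integral_preimage (lift f z) 0).trans ?_
    congr 1
    ext x
    rw [← hf.lift_proj, proj_two_pi_smul]
    rfl
  rw [h1, Measure.setIntegral_comp_smul_of_pos volume (fun φ => f (φ, z)) _ (by positivity),
    two_pi_smul_pi_Ioc, Module.finrank_fin_fun, smul_eq_mul]
  congr 1
  exact setIntegral_congr_set Measure.pi_Ioc_ae_eq_pi_Icc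

lemma transport_const_eq_dblAvg (hf : PeriodicSymb a b f) (ω : Fin n → ℝ) (q : PhaseSpace n) :
    transport (flowMeasure n) (flowMap ω) (flowKernel (fun _ => (2 * π)⁻¹) 0) f q =
      dblAvg n (fun φ x ξ => f (φ, x, ξ)) q.2.1 q.2.2 := by
  have hA := transport_integrable (admissible_flow (K := fun _ => (2 * π)⁻¹) continuous_const 0 ω)
    hf.continuous q
  simp only [flowMap, flowKernel, zero_mul, add_zero, act_eq] at hA
  have h2 : ∀ (s : ℝ) (w : ℝ × ℝ),
      ∫ t, (2 * π)⁻¹ * f (q.1 + (s • ω - ang t), w) ∂torusMeasure n = ((2 * π) ^ (n + 1))⁻¹ *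
        ∫ φ in Set.univ.pi fun _ => Set.Icc 0 (2 * π), f (φ, w) := by
    intro s w
    simp only [← add_sub_assoc, hf.per.lift_sub]
    rw [pow_succ', mul_inv (2 * π), mul_assoc (2 * π)⁻¹]
    rw [MeasureTheory.integral_const_mul, integral_sub_left_eq_self (lift f w),
      integral_lift hf.per]
  have h3 : Integrable (Function.uncurry fun (φ : Fin n → ℝ) (s : ℝ) =>
      f (φ, q.2.1 * Real.cos s + q.2.2 * Real.sin s, q.2.2 * Real.cos s - q.2.1 * Real.sin s))
      ((volume.restrict (Set.univ.pi fun _ => Set.Icc 0 (2 * π))).prod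
        (volume.restrict (Set.Ioc 0 (2 * π)))) := by
    rw [Measure.prod_restrict]
    have hc : Continuous (Function.uncurry fun (φ : Fin n → ℝ) (s : ℝ) =>
      f (φ, q.2.1 * Real.cos s + q.2.2 * Real.sin s,
        q.2.2 * Real.cos s - q.2.1 * Real.sin s)) := by
      have := hf.continuous
      simp only [Function.uncurry_def]
      fun_prop
    exact (hc.continuousOn.integrableOn_compact
      ((isCompact_univ_pi fun _ => isCompact_Icc).prod isCompact_Icc)).mono_set
      (Set.prod_mono_right Set.Ioc_subset_Icc_self)
  simp only [transport, flowMap, flowKernel, zero_mul, add_zero, act_eq]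
  rw [flowMeasure] at hA ⊢
  rw [integral_prod_symm _ hA]
  simp only [h2]
  rw [MeasureTheory.integral_const_mul, dblAvg]
  simp only [integral_of_le (show (0 : ℝ) ≤ 2 * π by positivity)]
  rw [integral_integral_swap h3]

end Average

section Solution

open UnitAddTorus

variable {f : PhaseSpace n → ℝ} {m₁ m₂ : ℝ} {ω : Fin n → ℝ} {K : UnitAddTorus (Fin n) → ℝ} {N : ℕ}

/-- The average over the angles and over the rotation flow. -/
def average (ω : Fin n → ℝ) (f : PhaseSpace n → ℝ) : PhaseSpace n → ℝ :=
  transport (flowMeasure n) (flowMap ω) (flowKernel (fun _ => (2 * π)⁻¹) 0) f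

/-- The candidate solution of the homological equation built from a torus kernel. -/
def solution (ω : Fin n → ℝ) (K : UnitAddTorus (Fin n) → ℝ) (N : ℕ) (f : PhaseSpace n → ℝ) :
    PhaseSpace n → ℝ :=
  transport (flowMeasure n) (flowMap ω) (flowKernel K 0) (sieve N f) +
    transport (flowMeasure n) (flowMap ω) (flowKernel (fun _ => 0) (2 * π)⁻¹) f

lemma rotGen_add {g : PhaseSpace n → ℝ} (hf : Differentiable ℝ f) (hg : Differentiable ℝ g) :
    rotGen (f + g) = rotGen f + rotGen g := by
  ext q
  simp [rotGen, fderiv_add (hf q) (hg q)]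

lemma euler_add {g : PhaseSpace n → ℝ} (hf : Differentiable ℝ f) (hg : Differentiable ℝ g) :
    euler (f + g) = euler f + euler g := by
  ext q
  simp [euler, fderiv_add (hf q) (hg q)]

lemma differentiable_flow_transport (hK : Continuous K) (β : ℝ) (hf : PeriodicSymb m₁ m₂ f) :
    Differentiable ℝ (transport (flowMeasure n) (flowMap ω) (flowKernel K β) f) :=
  differentiable_of_smooth (contDiff_transport (admissible_flow hK β ω) hf.smooth)

lemma dirDeriv_ang_average (hf : PeriodicSymb m₁ m₂ f) (j : Fin n) :
    dirDeriv (eAng j) (average ω f) = average ω (dirDeriv (eAng j) f) :=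
  dirDeriv_ang_transport (admissible_flow continuous_const _ _) hf.smooth j

lemma euler_average (hf : PeriodicSymb m₁ m₂ f) : euler (average ω f) = average ω (euler f) :=
  euler_transport (admissible_flow continuous_const _ _) hf.smooth

lemma dirDeriv_ang_solution (hK : Continuous K) (hf : PeriodicSymb m₁ m₂ f) (j : Fin n) :
    dirDeriv (eAng j) (solution ω K N f) = solution ω K N (dirDeriv (eAng j) f) := by
  rw [solution, dirDeriv_add (differentiable_flow_transport hK 0 (hf.sieve N))
    (differentiable_flow_transport continuous_const _ hf),
    dirDeriv_ang_transport (admissible_flow hK _ _) (hf.sieve N).smooth,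
    dirDeriv_ang_transport (admissible_flow continuous_const _ _) hf.smooth,
    sieve_dirDeriv_ang hf.smooth, solution]

lemma euler_solution (hK : Continuous K) (hf : PeriodicSymb m₁ m₂ f) :
    euler (solution ω K N f) = solution ω K N (euler f) := by
  rw [solution, euler_add (differentiable_flow_transport hK 0 (hf.sieve N))
    (differentiable_flow_transport continuous_const _ hf),
    euler_transport (admissible_flow hK _ _) (hf.sieve N).smooth,
    euler_transport (admissible_flow continuous_const _ _) hf.smooth,
    sieve_euler hf.smooth, solution]

/-- The average is invariant along the flow. -/
lemma flow_average (hf : PeriodicSymb m₁ m₂ f) (q : PhaseSpace n) :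
    rotGen (average ω f) q + ∑ j, ω j * dirDeriv (eAng j) (average ω f) q = 0 := by
  rw [average, flow_transport hf continuous_const, zero_mul]
  simp only [add_zero]
  rw [MeasureTheory.integral_const_mul, MeasureTheory.integral_const_mul,
    integral_sub_left_eq_self (lift f q.2), integral_sub_left_eq_self (lift f q.2), sub_self,
    zero_sub, neg_eq_zero, transport]
  simp [flowKernel]

/-- The homological equation. -/
lemma flow_solution (hK : Continuous K)
    (hsol : ∀ F g : UnitAddTorus (Fin n) → ℝ, Continuous F → Continuous g →
      (∀ k, mFourierCoeff (fun t => (F t : ℂ)) k =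
        fourierWeight N k * mFourierCoeff (fun t => (g t : ℂ)) k) →
      ∀ x, ∫ t, K t * F (x + toTorus ω - t) ∂torusMeasure n -
        ∫ t, K t * F (x - t) ∂torusMeasure n = g x - ∫ t, g t ∂torusMeasure n)
    (hf : PeriodicSymb m₁ m₂ f) (q : PhaseSpace n) :
    rotGen (solution ω K N f) q + ∑ j, ω j * dirDeriv (eAng j) (solution ω K N f) q =
      f q - average ω f q := by
  have hs := hf.sieve N
  have d1 := differentiable_flow_transport (ω := ω) hK 0 hs
  have d2 := differentiable_flow_transport (ω := ω) (K := fun _ => 0) continuous_const (2 * π)⁻¹ hf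
  have h1 := flow_transport hs hK 0 ω q
  have h2 := flow_transport hf (K := fun _ => 0) continuous_const (2 * π)⁻¹ ω q
  have h3 := hsol (lift (sieve N f) q.2) (lift f q.2) (hs.per.continuous_lift hs.continuous _)
    (hf.per.continuous_lift hf.continuous _) (mFourierCoeff_sieve hf q.2 N) (proj q.1)
  have h4 : transport (flowMeasure n) (flowMap ω) (flowKernel (fun _ => 0) 0) (sieve N f) q = 0 := by
    simp [transport, flowKernel]
  simp only [zero_mul, add_zero, zero_add, inv_mul_cancel₀ (show (2 * π) ≠ 0 by positivity),
    one_mul, integral_zero, sub_zero] at h1 h2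
  rw [integral_sub_left_eq_self (lift f q.2)] at h2
  rw [h3, h4, hf.per.lift_proj] at h1
  rw [solution, rotGen_add d1 d2]
  simp only [dirDeriv_add d1 d2, Pi.add_apply, mul_add, Finset.sum_add_distrib]
  rw [average]
  linarith

lemma symb_solution (hK : Continuous K)
    (hsol : ∀ {f}, PeriodicSymb m₁ m₂ f → ∀ q,
      rotGen (solution ω K N f) q + ∑ j, ω j * dirDeriv (eAng j) (solution ω K N f) q =
        f q - average ω f q)
    (hf : PeriodicSymb m₁ m₂ f) : Symb (m₁ + max m₂ 0) 0 (solution ω K N f) := by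
  have h0 := le_max_right m₂ 0
  have h0' := le_max_left m₂ 0
  let G : (PhaseSpace n → ℝ) → Prop := fun u =>
    ∃ f, PeriodicSymb m₁ m₂ f ∧ (u = solution ω K N f ∨ u = average ω f)
  have hweak : ∀ {K : UnitAddTorus (Fin n) → ℝ} {β : ℝ} {g}, Continuous K → PeriodicSymb m₁ m₂ g →
      ∀ N : ℕ, SymbN N (m₁ + max m₂ 0 + N) 0
        (transport (flowMeasure n) (flowMap ω) (flowKernel K β) g) := fun hK hg N =>
    symbN_transport (admissible_flow hK _ _) N hg.symb (by linarith) (by linarith)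
  have hang : ∀ u, G u → ∀ j, G (dirDeriv (eAng j) u) := by
    rintro u ⟨f, hf, rfl | rfl⟩ j
    · exact ⟨_, hf.ang j, .inl (dirDeriv_ang_solution hK hf j)⟩
    · exact ⟨_, hf.ang j, .inr (dirDeriv_ang_average hf j)⟩
  intro L
  refine symbN_of_stable (G := G) ?_ ?_ hang ?_ L ⟨f, hf, .inl rfl⟩
  · rintro u ⟨f, hf, rfl | rfl⟩ L
    · exact (hweak hK (hf.sieve N) L).add (hweak continuous_const hf L)
    · exact hweak continuous_const hf L
  · rintro u ⟨f, hf, rfl | rfl⟩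
    · exact ⟨_, hf.euler, .inl (euler_solution hK hf)⟩
    · exact ⟨_, hf.euler, .inr (euler_average hf)⟩
  · intro L hL u hu
    have hsum : SymbN L (m₁ + max m₂ 0) 0 (∑ j, fun q => ω j * dirDeriv (eAng j) u q) :=
      SymbN.sum _ fun j _ => (hL _ (hang u hu j)).const_mul _
    obtain ⟨f, hf, rfl | rfl⟩ := hu
    · convert (((hf.symb L).mono (by linarith) (by linarith)).sub
        (hL _ ⟨f, hf, .inr rfl⟩)).sub hsum using 1
      ext q
      rw [Pi.sub_apply, Pi.sub_apply, ← hsol hf q, Finset.sum_apply, add_sub_cancel_right]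
    · convert hsum.neg using 1
      ext q
      rw [Pi.neg_apply, Finset.sum_apply]
      exact eq_neg_of_add_eq_zero_left (flow_average hf q)

lemma angPeriodic_solution (hf : PeriodicSymb m₁ m₂ f) : AngPeriodic (solution ω K N f) := by
  have h : ∀ {c} {g : PhaseSpace n → ℝ}, AngPeriodic g →
      AngPeriodic (transport (flowMeasure n) (flowMap ω) c g) := by
    intro c g hg j q
    have e : ∀ y, act (flowMap ω y) (q + (2 * π) • eAng j) =
        act (flowMap ω y) q + (2 * π) • eAng j := by
      intro y
      simp only [act_eq]
      ext <;> simp [eAng]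
      ring
    simp only [transport, e, hg j _]
  intro j q
  exact congrArg₂ (· + ·) (h (hf.sieve N).per j q) (h hf.per j q)

lemma angPeriodic_iff_update :
    AngPeriodic f ↔ ∀ (φ : Fin n → ℝ) (j : Fin n) (x ξ : ℝ),
      f (Function.update φ j (φ j + 2 * π), x, ξ) = f (φ, x, ξ) := by
  have e : ∀ (φ : Fin n → ℝ) (j : Fin n) (x ξ : ℝ),
      ((Function.update φ j (φ j + 2 * π), x, ξ) : PhaseSpace n) =
        (φ, x, ξ) + (2 * π) • eAng j := by
    intro φ j x ξ
    refine Prod.ext ?_ (by simp [eAng])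
    ext i
    by_cases h : i = j
    · subst h
      simp [eAng]
    · simp [eAng, h]
  simp only [e]
  exact ⟨fun h φ j x ξ => h j _, fun h j q => h q.1 j q.2.1 q.2.2⟩

lemma deriv_rotation (hf : Differentiable ℝ f) (φ : Fin n → ℝ) (x ξ : ℝ) :
    deriv (fun t => f (φ, x * Real.cos t + ξ * Real.sin t, ξ * Real.cos t - x * Real.sin t)) 0 =
      rotGen f (φ, x, ξ) := by
  have h := (hasDerivAt_act_flow hf 0 0 (φ, x, ξ) 0).deriv
  simpa [act_eq, rot_apply, rotGen, fderiv_zero_mk] using h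

end Solution

end PhaseSpace

/-- harmonic-oscillator homological equation with Diophantine frequencies
`ω ∈ [1,2]^n`: for `p ∈ C^∞(𝕋^n × ℝ²)` of class `S^{m₁,m₂}` uniformly in the angles there
is `χ ∈ C^∞(𝕋^n × ℝ²)` of class `S^{m₁+[m₂],0}` solving
`(d/dt)|₀ χ(φ,R_t(x,ξ)) + ω·∂_φχ = p - ⟨p̄⟩`. -/
theorem stmt10 (n : ℕ) (hn : 1 ≤ n) (τ γ : ℝ) (hτ : 0 < τ) (hγ : 0 < γ)
    (ω : Fin n → ℝ) (hω : ∀ j, ω j ∈ Set.Icc (1:ℝ) 2)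
    (hdio : ∀ (k₀ : ℤ) (k : Fin n → ℤ), (k₀, k) ≠ 0 →
      γ / (1 + (∑ j, |(k j : ℝ)|) ^ τ) ≤ |∑ j, ω j * (k j : ℝ) + (k₀ : ℝ)|)
    (m₁ m₂ : ℝ) (p : (Fin n → ℝ) → ℝ → ℝ → ℝ)
    (hsm : ContDiff ℝ (⊤ : ℕ∞) fun q : (Fin n → ℝ) × ℝ × ℝ => p q.1 q.2.1 q.2.2)
    (hper : ∀ (φ : Fin n → ℝ) (j : Fin n) (x ξ : ℝ),
      p (Function.update φ j (φ j + 2 * π)) x ξ = p φ x ξ)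
    (hpb : ∀ (β : Fin n → ℕ) (k₁ k₂ : ℕ), ∃ C : ℝ, ∀ (φ : Fin n → ℝ) (x ξ : ℝ),
      |multiPderiv n β (fun φ' => iteratedDeriv k₁ (fun ξ' =>
          iteratedDeriv k₂ (fun x' => p φ' x' ξ') x) ξ) φ|
        ≤ C * Real.sqrt (1 + x ^ 2 + ξ ^ 2) ^ (m₁ - (k₁ : ℝ))
            * Real.sqrt (1 + x ^ 2) ^ (m₂ - (k₂ : ℝ))) :
    ∃ χ : (Fin n → ℝ) → ℝ → ℝ → ℝ,
      (ContDiff ℝ (⊤ : ℕ∞) fun q : (Fin n → ℝ) × ℝ × ℝ => χ q.1 q.2.1 q.2.2) ∧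
      (∀ (φ : Fin n → ℝ) (j : Fin n) (x ξ : ℝ),
        χ (Function.update φ j (φ j + 2 * π)) x ξ = χ φ x ξ) ∧
      (∀ (β : Fin n → ℕ) (k₁ k₂ : ℕ), ∃ C : ℝ, ∀ (φ : Fin n → ℝ) (x ξ : ℝ),
        |multiPderiv n β (fun φ' => iteratedDeriv k₁ (fun ξ' =>
            iteratedDeriv k₂ (fun x' => χ φ' x' ξ') x) ξ) φ|
          ≤ C * Real.sqrt (1 + x ^ 2 + ξ ^ 2) ^ (m₁ + max m₂ 0 - (k₁ : ℝ))
              * Real.sqrt (1 + x ^ 2) ^ (-(k₂ : ℝ))) ∧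
      ∀ (φ : Fin n → ℝ) (x ξ : ℝ),
        deriv (fun t => χ φ (x * Real.cos t + ξ * Real.sin t)
            (ξ * Real.cos t - x * Real.sin t)) 0
          + ∑ j, ω j * pderivAt n j (fun φ' => χ φ' x ξ) φ
        = p φ x ξ - dblAvg n p x ξ := by
  have hP : PhaseSpace.PeriodicSymb m₁ m₂ (fun q : PhaseSpace n => p q.1 q.2.1 q.2.2) :=
    ⟨PhaseSpace.symb_of_bound hsm hpb, PhaseSpace.angPeriodic_iff_update.2 hper⟩
  obtain ⟨K, hK, hsol⟩ := PhaseSpace.exists_dio_kernel hτ hγ hdio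
  have hflow := fun {f} (hf : PhaseSpace.PeriodicSymb m₁ m₂ f) q =>
    PhaseSpace.flow_solution hK hsol hf q
  have hu := PhaseSpace.symb_solution hK hflow hP
  have hud : Differentiable ℝ (PhaseSpace.solution ω K (⌈τ⌉₊ + 1)
      fun q : PhaseSpace n => p q.1 q.2.1 q.2.2) := hu.contDiff.differentiable (by simp)
  refine ⟨fun φ x ξ => PhaseSpace.solution ω K (⌈τ⌉₊ + 1)
    (fun q : PhaseSpace n => p q.1 q.2.1 q.2.2) (φ, x, ξ), hu.contDiff,
    PhaseSpace.angPeriodic_iff_update.1 (PhaseSpace.angPeriodic_solution hP),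
    fun β k₁ k₂ => ?_, fun φ x ξ => ?_⟩
  · simpa only [zero_sub] using hu.bound β k₁ k₂
  · simp only [PhaseSpace.deriv_rotation hud, PhaseSpace.pderivAt_eq hud]
    exact (hflow hP (φ, x, ξ)).trans
      (congrArg _ (PhaseSpace.transport_const_eq_dblAvg hP ω (φ, x, ξ)))
end
end

section
/- Let l ≥ 1 be real, m ∈ ℝ, and let W ∈ C^∞([−1,1] × ℝ) satisfy |∂_x^k W(y,x)| ≤ C_k ⟨x⟩^{m−k} for all k ≥ 0, uniformly in y ∈ [−1,1]; set I(M) := ∫_{−1}^{1} W(y, M y)/√(1 − |y|^{2l}) dy. Let E₀ > 0 and let q̄ ∈ C^∞([E₀,∞)) satisfy 0 < c ≤ q̄(E) ≤ C for all E ≥ E₀ and |∂_E^j q̄(E)| ≤ C_j E^{−j} for every j ≥ 1. Then J(E) := I(E^{1/(2l)} q̄(E)) satisfies, for every integer k ≥ 0, |∂_E^k J(E)| ≤ C′_k E^{[m]/(2l) − k} for all E ≥ E₀. -/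
open Real MeasureTheory intervalIntegral

noncomputable section

/-- Japanese bracket `⟨x⟩ = √(1+x²)`. -/
def jap (x : ℝ) : ℝ := Real.sqrt (1 + x ^ 2)

/-- `I(M) = ∫_{-1}^1 W(y,My)/√(1-|y|^{2l}) dy`. -/
def Ifun (l : ℝ) (W : ℝ → ℝ → ℝ) (M : ℝ) : ℝ :=
  ∫ y in (-1:ℝ)..1, W y (M * y) / Real.sqrt (1 - |y| ^ (2 * l))

/-- `f` satisfies the order-`a` symbol estimates on `[E₀,∞)` up to the `n`-th derivative. -/
def IsSymbolUpTo (E₀ : ℝ) : ℕ → ℝ → (ℝ → ℝ) → Prop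
  | 0, a, f => ∃ C : ℝ, ∀ E, E₀ ≤ E → |f E| ≤ C * E ^ a
  | n + 1, a, f => (∃ C : ℝ, ∀ E, E₀ ≤ E → |f E| ≤ C * E ^ a) ∧
      ∃ g : ℝ → ℝ, (∀ E, E₀ ≤ E → HasDerivWithinAt f (g E) (Set.Ici E₀) E) ∧
        IsSymbolUpTo E₀ n (a - 1) g

namespace IsSymbolUpTo

variable {E₀ a b : ℝ} {n : ℕ} {f g : ℝ → ℝ}

lemma bound (hf : IsSymbolUpTo E₀ n a f) : ∃ C : ℝ, ∀ E, E₀ ≤ E → |f E| ≤ C * E ^ a := by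
  cases n with
  | zero => exact hf
  | succ n => exact hf.1

lemma of_succ (hf : IsSymbolUpTo E₀ (n + 1) a f) : IsSymbolUpTo E₀ n a f := by
  induction n generalizing a f with
  | zero => exact hf.1
  | succ n ih =>
    obtain ⟨hb, g, hg, hgs⟩ := hf
    exact ⟨hb, g, hg, ih hgs⟩

lemma bound_add (hf : IsSymbolUpTo E₀ n a f) (hg : IsSymbolUpTo E₀ n a g) :
    ∃ C : ℝ, ∀ E, E₀ ≤ E → |f E + g E| ≤ C * E ^ a := by
  obtain ⟨A, hA⟩ := hf.bound
  obtain ⟨B, hB⟩ := hg.bound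
  refine ⟨A + B, fun E hE => (abs_add_le _ _).trans ?_⟩
  rw [add_mul]
  exact add_le_add (hA E hE) (hB E hE)

lemma add (hf : IsSymbolUpTo E₀ n a f) (hg : IsSymbolUpTo E₀ n a g) :
    IsSymbolUpTo E₀ n a (fun E => f E + g E) := by
  induction n generalizing a f g with
  | zero => exact bound_add hf hg
  | succ n ih =>
    refine ⟨bound_add hf hg, ?_⟩
    obtain ⟨-, f', hf', hfs⟩ := hf
    obtain ⟨-, g', hg', hgs⟩ := hg
    exact ⟨fun E => f' E + g' E, fun E hE => (hf' E hE).add (hg' E hE), ih hfs hgs⟩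

lemma bound_const_mul (r : ℝ) (hf : IsSymbolUpTo E₀ n a f) :
    ∃ C : ℝ, ∀ E, E₀ ≤ E → |r * f E| ≤ C * E ^ a := by
  obtain ⟨A, hA⟩ := hf.bound
  refine ⟨|r| * A, fun E hE => ?_⟩
  rw [abs_mul, mul_assoc]
  exact mul_le_mul_of_nonneg_left (hA E hE) (abs_nonneg r)

lemma const_mul (r : ℝ) (hf : IsSymbolUpTo E₀ n a f) :
    IsSymbolUpTo E₀ n a (fun E => r * f E) := by
  induction n generalizing a f with
  | zero => exact hf.bound_const_mul r
  | succ n ih =>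
    refine ⟨hf.bound_const_mul r, ?_⟩
    obtain ⟨-, f', hf', hfs⟩ := hf
    exact ⟨fun E => r * f' E, fun E hE => (hf' E hE).const_mul r, ih hfs⟩

lemma bound_mul (hE₀ : 0 < E₀) (hf : IsSymbolUpTo E₀ n a f) (hg : IsSymbolUpTo E₀ n b g) :
    ∃ C : ℝ, ∀ E, E₀ ≤ E → |f E * g E| ≤ C * E ^ (a + b) := by
  obtain ⟨A, hA⟩ := hf.bound
  obtain ⟨B, hB⟩ := hg.bound
  refine ⟨A * B, fun E hE => ?_⟩
  rw [abs_mul, Real.rpow_add (hE₀.trans_le hE), mul_mul_mul_comm]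
  exact mul_le_mul (hA E hE) (hB E hE) (abs_nonneg _) ((abs_nonneg _).trans (hA E hE))

lemma mul (hE₀ : 0 < E₀) (hf : IsSymbolUpTo E₀ n a f) (hg : IsSymbolUpTo E₀ n b g) :
    IsSymbolUpTo E₀ n (a + b) (fun E => f E * g E) := by
  induction n generalizing a b f g with
  | zero => exact bound_mul hE₀ hf hg
  | succ n ih =>
    refine ⟨bound_mul hE₀ hf hg, ?_⟩
    have hf0 := hf.of_succ
    have hg0 := hg.of_succ
    obtain ⟨-, f', hf', hfs⟩ := hf
    obtain ⟨-, g', hg', hgs⟩ := hg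
    refine ⟨fun E => f' E * g E + f E * g' E, fun E hE => (hf' E hE).mul (hg' E hE), ?_⟩
    have h1 := ih hfs hg0
    have h2 := ih hf0 hgs
    rw [show a - 1 + b = a + b - 1 by ring] at h1
    rw [show a + (b - 1) = a + b - 1 by ring] at h2
    exact h1.add h2

lemma inv_id (hE₀ : 0 < E₀) (n : ℕ) : IsSymbolUpTo E₀ n (-1) (fun E => E⁻¹) := by
  have hb : ∃ C : ℝ, ∀ E, E₀ ≤ E → |E⁻¹| ≤ C * E ^ (-1 : ℝ) := by
    refine ⟨1, fun E hE => ?_⟩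
    have hE' := hE₀.trans_le hE
    rw [Real.rpow_neg_one, one_mul, abs_of_pos (inv_pos.2 hE')]
  induction n with
  | zero => exact hb
  | succ n ih =>
    refine ⟨hb, fun E => (-1) * (E⁻¹ * E⁻¹), fun E hE => ?_, ?_⟩
    · refine (hasDerivAt_inv (hE₀.trans_le hE).ne').hasDerivWithinAt.congr_deriv ?_
      rw [sq, mul_inv]; ring
    · have := (ih.mul hE₀ ih).const_mul (-1)
      rwa [show (-1 : ℝ) + -1 = -1 - 1 by ring] at this

lemma inv (hE₀ : 0 < E₀) {c : ℝ} (hc : 0 < c) (hfc : ∀ E, E₀ ≤ E → c ≤ f E)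
    (hf : IsSymbolUpTo E₀ n 0 f) : IsSymbolUpTo E₀ n 0 (fun E => (f E)⁻¹) := by
  have hb : ∃ C : ℝ, ∀ E, E₀ ≤ E → |(f E)⁻¹| ≤ C * E ^ (0 : ℝ) := by
    refine ⟨c⁻¹, fun E hE => ?_⟩
    rw [Real.rpow_zero, mul_one, abs_of_pos (inv_pos.2 (hc.trans_le (hfc E hE)))]
    exact inv_anti₀ hc (hfc E hE)
  induction n with
  | zero => exact hb
  | succ n ih =>
    refine ⟨hb, ?_⟩
    have hr := ih hf.of_succ
    obtain ⟨-, f', hf', hfs⟩ := hf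
    refine ⟨fun E => (-1) * ((f E)⁻¹ * (f E)⁻¹ * f' E), fun E hE => ?_, ?_⟩
    · refine ((hf' E hE).inv (hc.trans_le (hfc E hE)).ne').congr_deriv ?_
      rw [div_eq_mul_inv, sq, mul_inv]; ring
    · have := ((hr.mul hE₀ hr).mul hE₀ hfs).const_mul (-1)
      rwa [show (0 : ℝ) + 0 + (0 - 1) = 0 - 1 by ring] at this

lemma of_iteratedDerivWithin (hf : ContDiffOn ℝ (⊤ : ℕ∞) f (Set.Ici E₀))
    (hb : ∀ k : ℕ, ∃ C : ℝ, ∀ E, E₀ ≤ E →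
      |iteratedDerivWithin k f (Set.Ici E₀) E| ≤ C * E ^ (a - (k : ℝ))) (n : ℕ) :
    IsSymbolUpTo E₀ n a f := by
  have hb0 : ∃ C : ℝ, ∀ E, E₀ ≤ E → |f E| ≤ C * E ^ a := by
    simpa using hb 0
  induction n generalizing a f with
  | zero => exact hb0
  | succ n ih =>
    have hb' : ∀ k : ℕ, ∃ C : ℝ, ∀ E, E₀ ≤ E →
        |iteratedDerivWithin k (derivWithin f (Set.Ici E₀)) (Set.Ici E₀) E|
          ≤ C * E ^ (a - 1 - (k : ℝ)) := by
      intro k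
      obtain ⟨C, hC⟩ := hb (k + 1)
      refine ⟨C, fun E hE => ?_⟩
      rw [← iteratedDerivWithin_succ']
      convert hC E hE using 3
      push_cast; ring
    refine ⟨hb0, derivWithin f (Set.Ici E₀), fun E hE => ?_,
      ih (hf.derivWithin (uniqueDiffOn_Ici E₀) (by simp)) hb' (by simpa using hb' 0)⟩
    exact ((hf.differentiableOn (by simp)) E hE).hasDerivWithinAt

lemma abs_iteratedDerivWithin_le (hf : IsSymbolUpTo E₀ n a f) :
    ∃ C : ℝ, ∀ E, E₀ ≤ E →
      |iteratedDerivWithin n f (Set.Ici E₀) E| ≤ C * E ^ (a - (n : ℝ)) := by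
  induction n generalizing a f with
  | zero => simpa using hf.bound
  | succ n ih =>
    obtain ⟨-, g, hg, hgs⟩ := hf
    obtain ⟨C, hC⟩ := ih hgs
    refine ⟨C, fun E hE => ?_⟩
    have hEq : Set.EqOn (derivWithin f (Set.Ici E₀)) g (Set.Ici E₀) := fun x hx =>
      (hg x hx).derivWithin (uniqueDiffOn_Ici E₀ x hx)
    rw [iteratedDerivWithin_succ', iteratedDerivWithin_congr hEq hE]
    convert hC E hE using 3
    push_cast; ring

end IsSymbolUpTo

lemma one_le_jap (x : ℝ) : 1 ≤ jap x :=
  Real.one_le_sqrt.2 (by nlinarith [sq_nonneg x])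

lemma abs_le_jap (x : ℝ) : |x| ≤ jap x :=
  Real.abs_le_sqrt (by linarith)

lemma jap_le_one_add_abs (x : ℝ) : jap x ≤ 1 + |x| := by
  refine Real.sqrt_le_iff.2 ⟨by positivity, ?_⟩
  nlinarith [sq_abs x, abs_nonneg x]

lemma jap_le_jap {x y : ℝ} (h : |x| ≤ |y|) : jap x ≤ jap y :=
  Real.sqrt_le_sqrt (by linarith [sq_le_sq.2 h])

lemma jap_mul_rpow_le {s y x N : ℝ} (hs : 0 ≤ s) (hy : y ∈ Set.Icc (-1 : ℝ) 1) (hx : |x| ≤ N) :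
    jap (x * y) ^ s ≤ jap N ^ s := by
  refine Real.rpow_le_rpow (zero_le_one.trans (one_le_jap _)) (jap_le_jap ?_) hs
  rw [abs_mul]
  calc |x| * |y| ≤ |x| * 1 := mul_le_mul_of_nonneg_left (abs_le.2 hy) (abs_nonneg x)
    _ ≤ |N| := by rw [mul_one]; exact hx.trans (le_abs_self N)

lemma intervalIntegrable_inv_sqrt_one_sub_abs_rpow {l : ℝ} (hl : 1 ≤ l) :
    IntervalIntegrable (fun y : ℝ => (Real.sqrt (1 - |y| ^ (2 * l)))⁻¹) volume (-1) 1 := by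
  have h1 : IntervalIntegrable (fun y : ℝ => (1 - y) ^ (-(1 / 2) : ℝ)) volume (-1) 1 := by
    have := (intervalIntegrable_rpow' (a := 2) (b := 0) (r := -(1 / 2)) (by norm_num)).comp_sub_left 1
    norm_num at this ⊢
    exact this
  have h2 : IntervalIntegrable (fun y : ℝ => (y + 1) ^ (-(1 / 2) : ℝ)) volume (-1) 1 := by
    have := (intervalIntegrable_rpow' (a := 0) (b := 2) (r := -(1 / 2)) (by norm_num)).comp_add_right 1
    norm_num at this ⊢
    exact this
  refine (h1.add h2).mono_fun ?_ ?_
  · exact (by fun_prop : Measurable _).aestronglyMeasurable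
  · refine (ae_restrict_iff' measurableSet_uIoc).2 (Filter.Eventually.of_forall fun y hy => ?_)
    rw [Set.uIoc_of_le (by norm_num)] at hy
    have hy1 : 0 ≤ 1 - y := by linarith [hy.2]
    have hy2 : 0 ≤ y + 1 := by linarith [hy.1]
    have p1 := Real.rpow_nonneg hy1 (-(1 / 2))
    have p2 := Real.rpow_nonneg hy2 (-(1 / 2))
    beta_reduce
    rw [Real.norm_of_nonneg (by positivity), Real.norm_of_nonneg (add_nonneg p1 p2)]
    have habs : |y| ≤ 1 := abs_le.2 ⟨hy.1.le, hy.2⟩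
    have hpow : |y| ^ (2 * l) ≤ |y| := by
      simpa using Real.rpow_le_rpow_of_exponent_ge' (abs_nonneg y) habs zero_le_one
        (by linarith : (1 : ℝ) ≤ 2 * l)
    have key : (Real.sqrt (1 - |y| ^ (2 * l)))⁻¹ ≤ (1 - |y|) ^ (-(1 / 2) : ℝ) := by
      rcases habs.eq_or_lt with h | h
      · simp [h]
      · rw [Real.rpow_neg (by linarith), ← Real.sqrt_eq_rpow]
        exact inv_anti₀ (Real.sqrt_pos.2 (by linarith)) (Real.sqrt_le_sqrt (by linarith))
    rcases abs_cases y with ⟨h, -⟩ | ⟨h, -⟩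
    · rw [h] at key
      rw [h]; linarith
    · rw [h, sub_neg_eq_add, add_comm 1 y] at key
      rw [h]; linarith

section ScaledIntegral

variable {U D : ℝ → ℝ → ℝ} {w : ℝ → ℝ} {A B s M : ℝ}

lemma continuousOn_scaled
    (hU : ContinuousOn (fun q : ℝ × ℝ => U q.1 q.2) (Set.Icc (-1 : ℝ) 1 ×ˢ Set.univ)) (M : ℝ) :
    ContinuousOn (fun y => U y (M * y)) (Set.Icc (-1 : ℝ) 1) :=
  hU.comp (f := fun y => (y, M * y)) (by fun_prop) fun _ hy => ⟨hy, trivial⟩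

lemma intervalIntegrable_scaled (hw : IntervalIntegrable w volume (-1) 1)
    (hU : ContinuousOn (fun q : ℝ × ℝ => U q.1 q.2) (Set.Icc (-1 : ℝ) 1 ×ˢ Set.univ)) (M : ℝ) :
    IntervalIntegrable (fun y => U y (M * y) * w y) volume (-1) 1 :=
  hw.continuousOn_mul (by
    rw [Set.uIcc_of_le (by norm_num)]
    exact continuousOn_scaled hU M)

lemma abs_integral_scaled_le (hs : 0 ≤ s) (hw : IntervalIntegrable w volume (-1) 1)
    (hA : ∀ y ∈ Set.Icc (-1 : ℝ) 1, ∀ x, |U y x| ≤ A * jap x ^ s) (hA0 : 0 ≤ A) (M : ℝ) :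
    |∫ y in (-1 : ℝ)..1, U y (M * y) * w y| ≤ A * jap M ^ s * ∫ y in (-1 : ℝ)..1, |w y| := by
  rw [← intervalIntegral.integral_const_mul, ← Real.norm_eq_abs]
  refine intervalIntegral.norm_integral_le_of_norm_le (by norm_num)
    (Filter.Eventually.of_forall fun y hy => ?_) (hw.abs.const_mul _)
  have hy' : y ∈ Set.Icc (-1 : ℝ) 1 := Set.Ioc_subset_Icc_self hy
  rw [Real.norm_eq_abs, abs_mul]
  refine mul_le_mul_of_nonneg_right ((hA y hy' _).trans ?_) (abs_nonneg _)
  refine mul_le_mul_of_nonneg_left ((jap_mul_rpow_le hs hy' (le_refl |M|)).trans ?_) hA0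
  exact (congrArg (· ^ s) (by simp [jap])).le

lemma hasDerivAt_integral_scaled (hs : 0 ≤ s) (hw : IntervalIntegrable w volume (-1) 1)
    (hU : ContinuousOn (fun q : ℝ × ℝ => U q.1 q.2) (Set.Icc (-1 : ℝ) 1 ×ˢ Set.univ))
    (hD : ContinuousOn (fun q : ℝ × ℝ => D q.1 q.2) (Set.Icc (-1 : ℝ) 1 ×ˢ Set.univ))
    (hB : ∀ y ∈ Set.Icc (-1 : ℝ) 1, ∀ x, |x * D y x| ≤ B * jap x ^ s) (hB0 : 0 ≤ B)
    (hder : ∀ y ∈ Set.Icc (-1 : ℝ) 1, ∀ x, HasDerivAt (U y) (D y x) x) (hM : 0 < M) :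
    HasDerivAt (fun N => ∫ y in (-1 : ℝ)..1, U y (N * y) * w y)
      (∫ y in (-1 : ℝ)..1, y * D y (M * y) * w y) M := by
  have hIoc : Set.uIoc (-1 : ℝ) 1 = Set.Ioc (-1) 1 := Set.uIoc_of_le (by norm_num)
  have hmem : ∀ {y : ℝ}, y ∈ Set.uIoc (-1 : ℝ) 1 → y ∈ Set.Icc (-1 : ℝ) 1 := fun hy =>
    Set.Ioc_subset_Icc_self (hIoc ▸ hy)
  have hyD : ContinuousOn (fun q : ℝ × ℝ => q.1 * D q.1 q.2) (Set.Icc (-1 : ℝ) 1 ×ˢ Set.univ) :=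
    continuousOn_fst.mul hD
  refine (intervalIntegral.hasDerivAt_integral_of_dominated_loc_of_deriv_le
    (F := fun N y => U y (N * y) * w y) (F' := fun N y => y * D y (N * y) * w y)
    (bound := fun y => 2 / M * (B * jap (2 * M) ^ s) * |w y|)
    (s := Set.Ioo (M / 2) (2 * M)) (Ioo_mem_nhds (by linarith) (by linarith))
    (Filter.Eventually.of_forall fun N => ?_) (intervalIntegrable_scaled hw hU M) ?_ ?_
    (hw.abs.const_mul _) ?_).2
  · exact (intervalIntegrable_iff.1 (intervalIntegrable_scaled hw hU N)).aestronglyMeasurable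
  · exact (intervalIntegrable_iff.1
      (intervalIntegrable_scaled (U := fun y x => y * D y x) hw hyD M)).aestronglyMeasurable
  · refine Filter.Eventually.of_forall fun y hy N hN => ?_
    have hN0 : 0 < N := by linarith [hN.1]
    rw [Real.norm_eq_abs, abs_mul]
    refine mul_le_mul_of_nonneg_right ?_ (abs_nonneg _)
    have hJ : 0 ≤ B * jap (2 * M) ^ s :=
      mul_nonneg hB0 (Real.rpow_nonneg (zero_le_one.trans (one_le_jap _)) _)
    have h1 : |N * y * D y (N * y)| ≤ B * jap (2 * M) ^ s :=
      (hB y (hmem hy) _).trans (mul_le_mul_of_nonneg_left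
        (jap_mul_rpow_le hs (hmem hy) (by rw [abs_of_pos hN0]; exact hN.2.le)) hB0)
    have h2 : N⁻¹ ≤ 2 / M := by
      rw [← inv_div]
      exact inv_anti₀ (by linarith) hN.1.le
    calc |y * D y (N * y)| = N⁻¹ * |N * y * D y (N * y)| := by
          rw [mul_assoc, abs_mul N, abs_of_pos hN0, inv_mul_cancel_left₀ hN0.ne']
      _ ≤ 2 / M * (B * jap (2 * M) ^ s) :=
          mul_le_mul h2 h1 (abs_nonneg _) (by positivity)
  · refine Filter.Eventually.of_forall fun y hy N _ => ?_
    have h := (hder y (hmem hy) (N * y)).comp N ((hasDerivAt_id N).mul_const y)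
    refine (h.mul_const (w y)).congr_deriv ?_
    rw [one_mul, mul_comm (D y _)]

end ScaledIntegral

lemma hasDerivAt_snd_of_contDiffOn {F : ℝ × ℝ → ℝ} {s : Set ℝ} {n : WithTop ℕ∞} (hn : n ≠ 0)
    (hF : ContDiffOn ℝ n F (s ×ˢ Set.univ)) {y : ℝ} (hy : y ∈ s) (x : ℝ) :
    HasDerivAt (fun t => F (y, t)) (fderivWithin ℝ F (s ×ˢ Set.univ) (y, x) (0, 1)) x := by
  have h := ((hF.differentiableOn hn) (y, x) ⟨hy, trivial⟩).hasFDerivWithinAt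
  exact h.comp_hasDerivAt x ((hasDerivAt_const x y).prodMk (hasDerivAt_id x))
    (Filter.Eventually.of_forall fun t => ⟨hy, trivial⟩)

lemma contDiffOn_iteratedDeriv_snd {W : ℝ → ℝ → ℝ} {s : Set ℝ} (hs : UniqueDiffOn ℝ s)
    (hW : ContDiffOn ℝ (⊤ : ℕ∞) (fun q : ℝ × ℝ => W q.1 q.2) (s ×ˢ Set.univ)) (p : ℕ) :
    ContDiffOn ℝ (⊤ : ℕ∞) (fun q : ℝ × ℝ => iteratedDeriv p (W q.1) q.2) (s ×ˢ Set.univ) := by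
  induction p with
  | zero => simpa using hW
  | succ p ih =>
    have h := (ih.fderivWithin (m := (⊤ : ℕ∞)) (hs.prod uniqueDiffOn_univ) (by simp)).clm_apply
      (contDiffOn_const (c := ((0 : ℝ), (1 : ℝ))))
    refine h.congr fun q hq => ?_
    rw [iteratedDeriv_succ]
    exact (hasDerivAt_snd_of_contDiffOn (by simp) ih hq.1 q.2).deriv

lemma hasDerivAt_iteratedDeriv_snd {W : ℝ → ℝ → ℝ} {s : Set ℝ} (hs : UniqueDiffOn ℝ s)
    (hW : ContDiffOn ℝ (⊤ : ℕ∞) (fun q : ℝ × ℝ => W q.1 q.2) (s ×ˢ Set.univ)) (p : ℕ)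
    {y : ℝ} (hy : y ∈ s) (x : ℝ) :
    HasDerivAt (iteratedDeriv p (W y)) (iteratedDeriv (p + 1) (W y) x) x := by
  have h := hasDerivAt_snd_of_contDiffOn (by simp) (contDiffOn_iteratedDeriv_snd hs hW p) hy x
  rw [iteratedDeriv_succ]
  exact h.differentiableAt.hasDerivAt

lemma abs_pow_mul_le_jap_rpow {C m x v : ℝ} {p : ℕ} (hv : |v| ≤ C * jap x ^ (m - (p : ℝ))) :
    |x ^ p * v| ≤ |C| * jap x ^ max m 0 := by
  have hj : 0 < jap x := zero_lt_one.trans_le (one_le_jap x)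
  calc |x ^ p * v| = |x| ^ p * |v| := by rw [abs_mul, abs_pow]
    _ ≤ jap x ^ p * (|C| * jap x ^ (m - (p : ℝ))) := by
        refine mul_le_mul (pow_le_pow_left₀ (abs_nonneg x) (abs_le_jap x) p) (hv.trans ?_)
          (abs_nonneg v) (by positivity)
        exact mul_le_mul_of_nonneg_right (le_abs_self C) (by positivity)
    _ = |C| * jap x ^ m := by
        rw [mul_left_comm, ← Real.rpow_natCast, ← Real.rpow_add hj, add_sub_cancel]
    _ ≤ |C| * jap x ^ max m 0 :=
        mul_le_mul_of_nonneg_left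
          (Real.rpow_le_rpow_of_exponent_le (one_le_jap x) (le_max_left m 0)) (abs_nonneg C)

/-- The integral `∫_{-1}^1 (My)^p (∂_x^p W)(y, My) w(y) dy`. -/
def eulerIntegral (W : ℝ → ℝ → ℝ) (w : ℝ → ℝ) (p : ℕ) (M : ℝ) : ℝ :=
  ∫ y in (-1 : ℝ)..1, (M * y) ^ p * iteratedDeriv p (W y) (M * y) * w y

section EulerIntegral

variable {W : ℝ → ℝ → ℝ} {w : ℝ → ℝ} {m M : ℝ}

lemma exists_abs_eulerIntegral_le (hw : IntervalIntegrable w volume (-1) 1)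
    (hWb : ∀ k : ℕ, ∃ C : ℝ, ∀ y ∈ Set.Icc (-1 : ℝ) 1, ∀ x : ℝ,
      |iteratedDeriv k (W y) x| ≤ C * jap x ^ (m - (k : ℝ))) (p : ℕ) :
    ∃ K : ℝ, 0 ≤ K ∧ ∀ M, |eulerIntegral W w p M| ≤ K * jap M ^ max m 0 := by
  obtain ⟨C, hC⟩ := hWb p
  refine ⟨|C| * ∫ y in (-1 : ℝ)..1, |w y|, mul_nonneg (abs_nonneg C)
    (intervalIntegral.integral_nonneg (by norm_num) fun _ _ => abs_nonneg _), fun M => ?_⟩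
  rw [mul_right_comm]
  exact abs_integral_scaled_le (U := fun y x => x ^ p * iteratedDeriv p (W y) x)
    (le_max_right m 0) hw (fun y hy x => abs_pow_mul_le_jap_rpow (hC y hy x)) (abs_nonneg C) M

lemma hasDerivAt_eulerIntegral (hw : IntervalIntegrable w volume (-1) 1)
    (hWsm : ContDiffOn ℝ (⊤ : ℕ∞) (fun q : ℝ × ℝ => W q.1 q.2)
      (Set.Icc (-1 : ℝ) 1 ×ˢ Set.univ))
    (hWb : ∀ k : ℕ, ∃ C : ℝ, ∀ y ∈ Set.Icc (-1 : ℝ) 1, ∀ x : ℝ,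
      |iteratedDeriv k (W y) x| ≤ C * jap x ^ (m - (k : ℝ))) (p : ℕ) (hM : 0 < M) :
    HasDerivAt (eulerIntegral W w p)
      ((p * eulerIntegral W w p M + eulerIntegral W w (p + 1) M) * M⁻¹) M := by
  have hu : UniqueDiffOn ℝ (Set.Icc (-1 : ℝ) 1) := uniqueDiffOn_Icc (by norm_num)
  have hV : ∀ k, ContinuousOn (fun q : ℝ × ℝ => iteratedDeriv k (W q.1) q.2)
      (Set.Icc (-1 : ℝ) 1 ×ˢ Set.univ) := fun k =>
    (contDiffOn_iteratedDeriv_snd hu hWsm k).continuousOn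
  have hU : ∀ k, ContinuousOn (fun q : ℝ × ℝ => q.2 ^ k * iteratedDeriv k (W q.1) q.2)
      (Set.Icc (-1 : ℝ) 1 ×ˢ Set.univ) := fun k => (continuousOn_snd.pow k).mul (hV k)
  have hxD : ∀ y x : ℝ, x * (p * x ^ (p - 1) * iteratedDeriv p (W y) x
      + x ^ p * iteratedDeriv (p + 1) (W y) x) = p * (x ^ p * iteratedDeriv p (W y) x)
      + x ^ (p + 1) * iteratedDeriv (p + 1) (W y) x := by
    intro y x
    cases p with
    | zero => simp
    | succ p => rw [Nat.add_sub_cancel]; ring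
  obtain ⟨C₁, hC₁⟩ := hWb p
  obtain ⟨C₂, hC₂⟩ := hWb (p + 1)
  have h := hasDerivAt_integral_scaled (U := fun y x => x ^ p * iteratedDeriv p (W y) x)
    (D := fun y x => p * x ^ (p - 1) * iteratedDeriv p (W y) x
      + x ^ p * iteratedDeriv (p + 1) (W y) x) (B := p * |C₁| + |C₂|)
    (le_max_right m 0) hw (hU p)
    (((continuousOn_const.mul (continuousOn_snd.pow (p - 1))).mul (hV p)).add
      ((continuousOn_snd.pow p).mul (hV (p + 1)))) ?_ (by positivity) ?_ hM
  · refine h.congr_deriv ?_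
    symm
    rw [mul_comm, eulerIntegral, eulerIntegral, ← intervalIntegral.integral_const_mul,
      ← intervalIntegral.integral_add, ← intervalIntegral.integral_const_mul]
    · congr 1
      ext y
      have h1 := hxD y (M * y)
      rw [← mul_assoc (p : ℝ), ← add_mul, ← h1]
      field_simp
    · exact (intervalIntegrable_scaled (U := fun y x => x ^ p * iteratedDeriv p (W y) x)
        hw (hU p) M).const_mul _
    · exact intervalIntegrable_scaled
        (U := fun y x => x ^ (p + 1) * iteratedDeriv (p + 1) (W y) x) hw (hU (p + 1)) M
  · intro y hy x
    have h1 := abs_pow_mul_le_jap_rpow (hC₁ y hy x)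
    have h2 := abs_pow_mul_le_jap_rpow (hC₂ y hy x)
    rw [hxD, add_mul, mul_assoc]
    refine (abs_add_le _ _).trans (add_le_add ?_ h2)
    rw [abs_mul, Nat.abs_cast]
    exact mul_le_mul_of_nonneg_left h1 (Nat.cast_nonneg p)
  · intro y hy x
    exact (hasDerivAt_pow p x).mul (hasDerivAt_iteratedDeriv_snd hu hWsm p hy x)

end EulerIntegral

/-- with `W` as in Statement 13 and `q̄ ∈ C^∞([E₀,∞))` bounded above and
below by positive constants with `|∂_E^j q̄(E)| ≤ C_j E^{-j}` for `j ≥ 1`, the function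
`J(E) = I(E^{1/(2l)} q̄(E))` satisfies `|∂_E^k J(E)| ≤ C'_k E^{[m]/(2l)-k}` on `[E₀,∞)`. -/
theorem stmt14 (l : ℝ) (hl : 1 ≤ l) (m : ℝ) (W : ℝ → ℝ → ℝ)
    (hWsm : ContDiffOn ℝ (⊤ : ℕ∞) (fun q : ℝ × ℝ => W q.1 q.2)
      (Set.Icc (-1:ℝ) 1 ×ˢ Set.univ))
    (hWb : ∀ k : ℕ, ∃ C : ℝ, ∀ y ∈ Set.Icc (-1:ℝ) 1, ∀ x : ℝ,
      |iteratedDeriv k (W y) x| ≤ C * jap x ^ (m - (k : ℝ)))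
    (E₀ : ℝ) (hE₀ : 0 < E₀) (qbar : ℝ → ℝ)
    (hqsm : ContDiffOn ℝ (⊤ : ℕ∞) qbar (Set.Ici E₀))
    (c C : ℝ) (hc : 0 < c)
    (hqb : ∀ E : ℝ, E₀ ≤ E → c ≤ qbar E ∧ qbar E ≤ C)
    (hqd : ∀ j : ℕ, 1 ≤ j → ∃ Cj : ℝ, ∀ E : ℝ, E₀ ≤ E →
      |iteratedDerivWithin j qbar (Set.Ici E₀) E| ≤ Cj * E ^ (-(j : ℝ))) :
    ∀ k : ℕ, ∃ C' : ℝ, ∀ E : ℝ, E₀ ≤ E →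
      |iteratedDerivWithin k (fun E' => Ifun l W (E' ^ (1 / (2 * l)) * qbar E'))
          (Set.Ici E₀) E|
        ≤ C' * E ^ (max m 0 / (2 * l) - (k : ℝ)) := by
  have hα : 0 < 1 / (2 * l) := by positivity
  set α : ℝ := 1 / (2 * l) with hα_def
  set w : ℝ → ℝ := fun y => (Real.sqrt (1 - |y| ^ (2 * l)))⁻¹ with hw_def
  have hw : IntervalIntegrable w volume (-1) 1 :=
    intervalIntegrable_inv_sqrt_one_sub_abs_rpow hl
  have hq : ∀ n, IsSymbolUpTo E₀ n 0 qbar := by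
    refine IsSymbolUpTo.of_iteratedDerivWithin hqsm fun k => ?_
    rcases Nat.eq_zero_or_pos k with rfl | hk
    · refine ⟨C, fun E hE => ?_⟩
      have h := hqb E hE
      simpa [abs_of_pos (hc.trans_le h.1)] using h.2
    · simpa using hqd k hk
  have hq' : ∀ n, IsSymbolUpTo E₀ n (-1) (derivWithin qbar (Set.Ici E₀)) := by
    refine IsSymbolUpTo.of_iteratedDerivWithin
      (hqsm.derivWithin (uniqueDiffOn_Ici E₀) (by simp)) fun k => ?_
    obtain ⟨K, hK⟩ := hqd (k + 1) (Nat.succ_pos k)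
    refine ⟨K, fun E hE => ?_⟩
    rw [← iteratedDerivWithin_succ']
    convert hK E hE using 3
    push_cast; ring
  have hμ : ∀ n, IsSymbolUpTo E₀ n (-1)
      (fun E => α * E⁻¹ + derivWithin qbar (Set.Ici E₀) E * (qbar E)⁻¹) := by
    intro n
    have h := (hq' n).mul hE₀ ((hq n).inv hE₀ hc fun E hE => (hqb E hE).1)
    rw [add_zero] at h
    exact ((IsSymbolUpTo.inv_id hE₀ n).const_mul α).add h
  have hMpos : ∀ E, E₀ ≤ E → 0 < E ^ α * qbar E := fun E hE =>
    mul_pos (Real.rpow_pos_of_pos (hE₀.trans_le hE) _) (hc.trans_le (hqb E hE).1)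
  have hMder : ∀ E, E₀ ≤ E → HasDerivWithinAt (fun E => E ^ α * qbar E)
      (E ^ α * qbar E * (α * E⁻¹ + derivWithin qbar (Set.Ici E₀) E * (qbar E)⁻¹))
      (Set.Ici E₀) E := by
    intro E hE
    have hE' := hE₀.trans_le hE
    have hqE := (hc.trans_le (hqb E hE).1).ne'
    have h1 := (Real.hasDerivAt_rpow_const (p := α) (Or.inl hE'.ne')).hasDerivWithinAt
      (s := Set.Ici E₀)
    have h2 := ((hqsm.differentiableOn (by simp)) E hE).hasDerivWithinAt
    refine (h1.mul h2).congr_deriv ?_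
    rw [Real.rpow_sub_one hE'.ne']
    field_simp
  have hJ : ∀ n p, IsSymbolUpTo E₀ n (max m 0 / (2 * l))
      (fun E => eulerIntegral W w p (E ^ α * qbar E)) := by
    have hb : ∀ p, ∃ K : ℝ, ∀ E, E₀ ≤ E →
        |eulerIntegral W w p (E ^ α * qbar E)| ≤ K * E ^ (max m 0 / (2 * l)) := by
      intro p
      obtain ⟨K, hK0, hK⟩ := exists_abs_eulerIntegral_le (W := W) hw hWb p
      refine ⟨K * ((E₀ ^ α)⁻¹ + C) ^ max m 0, fun E hE => (hK _).trans ?_⟩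
      have hE' := hE₀.trans_le hE
      have hE₀α := Real.rpow_pos_of_pos hE₀ α
      have hEα := Real.rpow_pos_of_pos hE' α
      have hC : 0 ≤ C := (hc.trans_le ((hqb E hE).1.trans (hqb E hE).2)).le
      have hexp : E ^ (max m 0 / (2 * l)) = (E ^ α) ^ max m 0 := by
        rw [← Real.rpow_mul hE'.le, hα_def, one_div_mul_eq_div]
      rw [mul_assoc, hexp, ← Real.mul_rpow (by positivity) hEα.le]
      refine mul_le_mul_of_nonneg_left (Real.rpow_le_rpow
        (zero_le_one.trans (one_le_jap _)) ?_ (le_max_right m 0)) hK0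
      refine (jap_le_one_add_abs _).trans ?_
      rw [abs_of_pos (hMpos E hE), add_mul]
      refine add_le_add ?_ ?_
      · rw [← div_eq_inv_mul, one_le_div hE₀α]
        exact Real.rpow_le_rpow hE₀.le hE hα.le
      · rw [mul_comm]
        exact mul_le_mul_of_nonneg_right (hqb E hE).2 hEα.le
    intro n
    induction n with
    | zero => exact hb
    | succ n ih =>
      intro p
      refine ⟨hb p, _, fun E hE => ?_,
        (((ih p).const_mul p).add (ih (p + 1))).mul hE₀ (hμ n)⟩
      have h := (hasDerivAt_eulerIntegral hw hWsm hWb p (hMpos E hE)).comp_hasDerivWithinAt E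
        (hMder E hE)
      refine h.congr_deriv ?_
      rw [mul_assoc, inv_mul_cancel_left₀ (hMpos E hE).ne']
  intro k
  have hI : (fun E' => Ifun l W (E' ^ α * qbar E'))
      = fun E' => eulerIntegral W w 0 (E' ^ α * qbar E') := by
    ext E
    simp [Ifun, eulerIntegral, hw_def, div_eq_mul_inv]
  rw [hI]
  exact (hJ k 0).abs_iteratedDerivWithin_le
end
end
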